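/- arXiv:2605.27831 — 17 statements merged into one kernel-verified Lean document; each statement's English description precedes it below -/
import Mathlib

section
/- Let τ > 0 and κ > 0 be real numbers, and let x ≥ 0 and y ≥ 0 be real numbers. Then x·y − κ·exp(x²/(2τ)) ≤ y·√(τ·log(1 + τ·y²/κ²)) − κ. -/
/-- Quadratic–exponential Fenchel envelope:
for τ, κ > 0 and x, y ≥ 0,
x·y − κ·exp(x²/(2τ)) ≤ y·√(τ·log(1 + τ·y²/κ²)) − κ. -/
theorem quad_exp_fenchel_envelope (τ κ x y : ℝ) (hτ : 0 < τ) (hκ : 0 < κ)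
    (hx : 0 ≤ x) (hy : 0 ≤ y) :
    x * y - κ * Real.exp (x ^ 2 / (2 * τ)) ≤
      y * Real.sqrt (τ * Real.log (1 + τ * y ^ 2 / κ ^ 2)) - κ := by
  set L := Real.log (1 + τ * y ^ 2 / κ ^ 2) with hL
  have hq : 0 ≤ τ * y ^ 2 / κ ^ 2 := by positivity
  have hL0 : 0 ≤ L := Real.log_nonneg (by linarith)
  have hexpL : Real.exp L = 1 + τ * y ^ 2 / κ ^ 2 := Real.exp_log (by linarith)
  set r := Real.sqrt (τ * L) with hr
  have hr0 : 0 ≤ r := Real.sqrt_nonneg _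
  have hr2 : r ^ 2 = τ * L := Real.sq_sqrt (by positivity)
  by_cases hxr : x ≤ r
  · have h1 : 1 ≤ Real.exp (x ^ 2 / (2 * τ)) := Real.one_le_exp (by positivity)
    nlinarith [mul_le_mul_of_nonneg_left hxr hy, mul_le_mul_of_nonneg_left h1 hκ.le]
  · have hxr : r < x := not_le.mp hxr
    set E := Real.exp (L / 2) with hE
    have hE1 : 1 ≤ E := Real.one_le_exp (by positivity)
    have hE2 : E ^ 2 = Real.exp L := by
      rw [hE, ← Real.exp_nat_mul]; congr 1; push_cast; ring
    -- slope bound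
    have hLE : Real.exp L - 1 ≤ Real.exp L * L := by
      have h := Real.add_one_le_exp (-L)
      have h2 : Real.exp L * Real.exp (-L) = 1 := by rw [← Real.exp_add]; simp
      nlinarith [mul_le_mul_of_nonneg_left h (Real.exp_pos L).le]
    have hslope : y ≤ κ * E * r / τ := by
      refine (pow_le_pow_iff_left₀ hy (by positivity) two_ne_zero).mp ?_
      have e1 : (κ * E * r / τ) ^ 2 = κ ^ 2 / τ * (Real.exp L * L) := by
        rw [div_pow, mul_pow, mul_pow, hE2, hr2]; field_simp
      have e2 : y ^ 2 = κ ^ 2 / τ * (Real.exp L - 1) := by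
        rw [hexpL]; field_simp; ring
      rw [e1, e2]
      exact mul_le_mul_of_nonneg_left hLE (by positivity)
    have hsplit : Real.exp (x ^ 2 / (2 * τ)) = E * Real.exp ((x ^ 2 - r ^ 2) / (2 * τ)) := by
      rw [hE, ← Real.exp_add, hr2]; congr 1; field_simp; ring
    have hlow : 1 + r * (x - r) / τ ≤ Real.exp ((x ^ 2 - r ^ 2) / (2 * τ)) := by
      have h := Real.add_one_le_exp ((x ^ 2 - r ^ 2) / (2 * τ))
      have h2 : (x ^ 2 - r ^ 2) / (2 * τ) - r * (x - r) / τ = (x - r) ^ 2 / (2 * τ) := by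
        field_simp; ring
      have h3 : 0 ≤ (x - r) ^ 2 / (2 * τ) := by positivity
      linarith
    have hA := mul_le_mul_of_nonneg_left hlow (by positivity : 0 ≤ κ * E)
    have hB := mul_le_mul_of_nonneg_right hslope (sub_nonneg.mpr hxr.le)
    have hC := mul_le_mul_of_nonneg_left hE1 hκ.le
    have hD : κ * E * (1 + r * (x - r) / τ) = κ * E + κ * E * r / τ * (x - r) := by
      field_simp
    rw [hsplit]
    linarith
end

section
/- Let a ≥ 0 and v ≥ 0 be real numbers and set r = √(log(1 + a²)). Then a·v − exp(v²/2) ≤ a·r − 1. -/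
/-- Normalized core inequality: for a, v ≥ 0 and r = √(log(1 + a²)),
a·v − exp(v²/2) ≤ a·r − 1. -/
theorem normalized_core_inequality (a v : ℝ) (ha : 0 ≤ a) (hv : 0 ≤ v) :
    a * v - Real.exp (v ^ 2 / 2) ≤ a * Real.sqrt (Real.log (1 + a ^ 2)) - 1 := by
  have hpos : (0 : ℝ) < 1 + a ^ 2 := by positivity
  have hlog : 0 ≤ Real.log (1 + a ^ 2) := Real.log_nonneg (by nlinarith [sq_nonneg a])
  have hr0 := Real.sqrt_nonneg (Real.log (1 + a ^ 2))
  have hr2 := Real.sq_sqrt hlog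
  have hlow := Real.one_sub_inv_le_log_of_pos hpos
  rw [← hr2] at hlow
  set r := Real.sqrt (Real.log (1 + a ^ 2)) with hr
  have hE1 : 1 ≤ Real.exp (v ^ 2 / 2) := Real.one_le_exp (by positivity)
  rcases le_total v r with h | h
  · nlinarith [mul_le_mul_of_nonneg_left h ha]
  have hs1 : 1 ≤ Real.exp (r ^ 2 / 2) := Real.one_le_exp (by positivity)
  have hs2 : Real.exp (r ^ 2 / 2) ^ 2 = 1 + a ^ 2 := by
    rw [← Real.exp_nat_mul, show ((2 : ℕ) : ℝ) * (r ^ 2 / 2) = r ^ 2 by push_cast; ring, hr2,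
      Real.exp_log hpos]
  have hexp : Real.exp (v ^ 2 / 2) =
      Real.exp (r ^ 2 / 2) * Real.exp ((v ^ 2 - r ^ 2) / 2) := by
    rw [← Real.exp_add]; congr 1; ring
  have hconv := Real.add_one_le_exp ((v ^ 2 - r ^ 2) / 2)
  set s := Real.exp (r ^ 2 / 2) with hs
  have hmul : a ^ 2 ≤ r ^ 2 * (1 + a ^ 2) := by
    have h1 := mul_le_mul_of_nonneg_right hlow hpos.le
    rw [sub_mul, inv_mul_cancel₀ hpos.ne'] at h1
    linarith
  have hsr : a ≤ r * s := by
    refine (sq_le_sq₀ ha (by positivity)).1 ?_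
    rw [mul_pow, hs2]; exact hmul
  have h1 : 1 + r * (v - r) ≤ Real.exp ((v ^ 2 - r ^ 2) / 2) := by
    nlinarith [sq_nonneg (v - r)]
  have h2 := mul_le_mul_of_nonneg_left h1 (by linarith : 0 ≤ s)
  have h3 := mul_le_mul_of_nonneg_right hsr (sub_nonneg.2 h)
  rw [hexp]
  nlinarith
end

section
/- Let ε > 0 and let T ≥ 1 be an integer. Then for every real s with 0 ≤ s ≤ T, ε·2^T·Γ((T+1)/2 + s/2)·Γ((T+1)/2 − s/2)/(π·T!) ≥ (ε/(e·√(π·T)))·exp(s²/(4(T+1))). -/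
lemma kt_mid (x y : ℝ) (hx : 0 < x) (hy : 0 < y) :
    Real.Gamma ((x + y) / 2) ^ 2 ≤ Real.Gamma x * Real.Gamma y := by
  have h := Real.Gamma_mul_add_mul_le_rpow_Gamma_mul_rpow_Gamma hx hy
    (a := 1 / 2) (b := 1 / 2) (by norm_num) (by norm_num) (by norm_num)
  have hgx := Real.Gamma_pos_of_pos hx
  have hgy := Real.Gamma_pos_of_pos hy
  rw [← Real.sqrt_eq_rpow, ← Real.sqrt_eq_rpow,
    show (1 / 2 * x + 1 / 2 * y : ℝ) = (x + y) / 2 by ring] at h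
  have h0 := Real.Gamma_pos_of_pos (show 0 < (x + y) / 2 by positivity)
  calc _ ≤ (√(Real.Gamma x) * √(Real.Gamma y)) ^ 2 := by gcongr
    _ = _ := by rw [mul_pow, Real.sq_sqrt hgx.le, Real.sq_sqrt hgy.le]

lemma kt_ratio (u : ℝ) (hu : 0 ≤ u) (N : ℕ) : ∀ a : ℝ, u < a →
    Real.exp (u ^ 2 * (1 / a - 1 / (a + N))) * Real.Gamma a ^ 2 ≤
      Real.Gamma (a + u) * Real.Gamma (a - u) := by
  induction N with
  | zero =>
    intro a ha
    have h := kt_mid (a + u) (a - u) (by linarith) (by linarith)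
    rw [show (a + u + (a - u)) / 2 = a by ring] at h
    simpa using h
  | succ N ih =>
    intro a ha
    have ha0 : 0 < a := by linarith
    have h := ih (a + 1) (by linarith)
    rw [show a + 1 + u = (a + u) + 1 by ring, show a + 1 - u = (a - u) + 1 by ring,
      Real.Gamma_add_one ha0.ne', Real.Gamma_add_one (by positivity : a + u ≠ 0),
      Real.Gamma_add_one (sub_pos.2 ha).ne'] at h
    have hd : 0 < (a + u) * (a - u) := mul_pos (by linarith) (by linarith)
    have h1 : Real.exp (u ^ 2 * (1 / a - 1 / (a + 1))) * ((a + u) * (a - u)) ≤ a ^ 2 := by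
      have h2 : u ^ 2 * (1 / a - 1 / (a + 1)) ≤ u ^ 2 / a ^ 2 := by
        rw [div_eq_mul_one_div (u ^ 2) (a ^ 2)]
        gcongr
        rw [div_sub_div _ _ ha0.ne' (by positivity), div_le_div_iff₀ (by positivity) (by positivity)]
        nlinarith
      have h3 := Real.add_one_le_exp (-(u ^ 2 / a ^ 2))
      have h4 : (a + u) * (a - u) = a ^ 2 * (-(u ^ 2 / a ^ 2) + 1) := by field_simp; ring
      calc _ ≤ Real.exp (u ^ 2 / a ^ 2) * (a ^ 2 * Real.exp (-(u ^ 2 / a ^ 2))) := by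
            rw [h4]; rw [h4] at hd
            gcongr
        _ = a ^ 2 := by
            rw [Real.exp_neg]; field_simp
    have e : Real.exp (u ^ 2 * (1 / a - 1 / (a + (N + 1 : ℕ)))) =
        Real.exp (u ^ 2 * (1 / a - 1 / (a + 1))) *
        Real.exp (u ^ 2 * (1 / (a + 1) - 1 / (a + 1 + N))) := by
      rw [← Real.exp_add]; push_cast; congr 1
      rw [show a + ((N : ℝ) + 1) = a + 1 + N by ring]; ring
    rw [e]
    refine le_of_mul_le_mul_left ?_ hd
    set X := Real.exp (u ^ 2 * (1 / (a + 1) - 1 / (a + 1 + N)))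
    set Y := Real.exp (u ^ 2 * (1 / a - 1 / (a + 1)))
    have hX : 0 ≤ X * Real.Gamma a ^ 2 := by positivity
    nlinarith [mul_le_mul_of_nonneg_right h1 hX]

/-- Pointwise exponential lower bound for the Krichevsky–Trofimov potential on [0, T]:
for ε > 0, integer T ≥ 1, and 0 ≤ s ≤ T,
ε·2^T·Γ((T+1)/2 + s/2)·Γ((T+1)/2 − s/2)/(π·T!) ≥ (ε/(e·√(π·T)))·exp(s²/(4(T+1))). -/
theorem kt_potential_exp_lower_bound (ε : ℝ) (hε : 0 < ε) (T : ℕ) (hT : 1 ≤ T)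
    (s : ℝ) (hs0 : 0 ≤ s) (hsT : s ≤ (T : ℝ)) :
    ε / (Real.exp 1 * Real.sqrt (Real.pi * T)) * Real.exp (s ^ 2 / (4 * ((T : ℝ) + 1))) ≤
      ε * 2 ^ T * Real.Gamma (((T : ℝ) + 1) / 2 + s / 2) *
        Real.Gamma (((T : ℝ) + 1) / 2 - s / 2) / (Real.pi * (Nat.factorial T : ℝ)) := by
  have hT' : (1 : ℝ) ≤ T := by exact_mod_cast hT
  have hpi := Real.pi_pos
  obtain ⟨a, ha⟩ : ∃ a : ℝ, a = ((T : ℝ) + 1) / 2 := ⟨_, rfl⟩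
  have ha0 : 0 < a := by rw [ha]; positivity
  have hr := kt_ratio (s / 2) (by positivity) (T + 1) a (by rw [ha]; linarith)
  have hG := Real.Gamma_pos_of_pos ha0
  have hG2 := Real.Gamma_pos_of_pos (show 0 < a + 1 / 2 by positivity)
  have hE : Real.exp (s ^ 2 / (4 * ((T : ℝ) + 1))) ≤
      Real.exp ((s / 2) ^ 2 * (1 / a - 1 / (a + (T + 1 : ℕ)))) := by
    apply Real.exp_le_exp.2
    rw [ha]; push_cast
    have : (s / 2) ^ 2 * (1 / (((T : ℝ) + 1) / 2) - 1 / (((T : ℝ) + 1) / 2 + (T + 1)))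
      = s ^ 2 / (3 * ((T : ℝ) + 1)) := by
      have : (T : ℝ) + 1 ≠ 0 := by positivity
      rw [show ((T : ℝ) + 1) / 2 + (T + 1) = 3 * (T + 1) / 2 by ring]
      field_simp; ring
    rw [this]
    gcongr; norm_num
  have hdup : Real.Gamma a * Real.Gamma (a + 1 / 2) * 2 ^ T = (T.factorial : ℝ) * √Real.pi := by
    rw [Real.Gamma_mul_Gamma_add_half_of_pos ha0, show 2 * a = (T : ℝ) + 1 by rw [ha]; ring,
      Real.Gamma_nat_eq_factorial, show (1 : ℝ) - (T + 1) = -(T : ℝ) by ring,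
      Real.rpow_neg (by norm_num), Real.rpow_natCast]
    field_simp
  have hm : Real.Gamma (a + 1 / 2) ≤ √T * Real.Gamma a := by
    have h := kt_mid a (a + 1) ha0 (by linarith)
    rw [Real.Gamma_add_one ha0.ne', show (a + (a + 1)) / 2 = a + 1 / 2 by ring] at h
    refine abs_le_of_sq_le_sq' ?_ (by positivity) |>.2
    rw [mul_pow, Real.sq_sqrt (by positivity)]
    have : a ≤ T := by rw [ha]; linarith
    nlinarith [mul_le_mul_of_nonneg_right this (sq_nonneg (Real.Gamma a))]
  have hfac : (0 : ℝ) < T.factorial := by exact_mod_cast T.factorial_pos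
  have h0 : 1 / √(Real.pi * T) ≤ 2 ^ T * Real.Gamma a ^ 2 / (Real.pi * T.factorial) := by
    have hsp : 0 < √Real.pi := Real.sqrt_pos.2 hpi
    have hsT : 0 < √(T : ℝ) := Real.sqrt_pos.2 (by linarith)
    rw [Real.sqrt_mul hpi.le, div_le_div_iff₀ (by positivity) (by positivity)]
    have hp : Real.pi = √Real.pi * √Real.pi := (Real.mul_self_sqrt hpi.le).symm
    calc 1 * (Real.pi * (T.factorial : ℝ)) = √Real.pi * ((T.factorial : ℝ) * √Real.pi) := by
          nth_rewrite 1 [hp]; ring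
      _ = √Real.pi * (2 ^ T * Real.Gamma a * Real.Gamma (a + 1 / 2)) := by rw [← hdup]; ring
      _ ≤ √Real.pi * (2 ^ T * Real.Gamma a * (√T * Real.Gamma a)) := by gcongr
      _ = _ := by ring
  have he : 1 ≤ Real.exp 1 := Real.one_le_exp (by norm_num)
  have hsq : 0 < √(Real.pi * T) := Real.sqrt_pos.2 (by positivity)
  rw [← ha]
  calc _ ≤ ε / (1 * √(Real.pi * T)) *
        Real.exp ((s / 2) ^ 2 * (1 / a - 1 / (a + (T + 1 : ℕ)))) := by gcongr
    _ = ε * (1 / √(Real.pi * T)) *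
        Real.exp ((s / 2) ^ 2 * (1 / a - 1 / (a + (T + 1 : ℕ)))) := by ring
    _ ≤ ε * (2 ^ T * Real.Gamma a ^ 2 / (Real.pi * T.factorial)) *
        Real.exp ((s / 2) ^ 2 * (1 / a - 1 / (a + (T + 1 : ℕ)))) := by gcongr
    _ = ε * 2 ^ T * (Real.exp ((s / 2) ^ 2 * (1 / a - 1 / (a + (T + 1 : ℕ)))) *
        Real.Gamma a ^ 2) / (Real.pi * T.factorial) := by ring
    _ ≤ ε * 2 ^ T * (Real.Gamma (a + s / 2) * Real.Gamma (a - s / 2)) /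
        (Real.pi * T.factorial) := by gcongr
    _ = _ := by ring
end

section
/- Let ε > 0, let T ≥ 1 be an integer, and let θ ≥ 0 be real. Then sup over real s with 0 ≤ s ≤ T of (θ·s − F_T^{KT}(s)) is at most θ·√(2(T+1)·log(1 + 2e²·π·T·(T+1)·θ²/ε²)) − ε/(e·√(π·T)). -/
/-- The KT potential with endowment ε:
F_t^{KT}(x) = ε·2^t·Γ((t+1)/2 + x/2)·Γ((t+1)/2 − x/2)/(π·t!). -/
noncomputable def FKT (ε : ℝ) (t : ℕ) (x : ℝ) : ℝ :=
  ε * 2 ^ t * Real.Gamma (((t : ℝ) + 1) / 2 + x / 2) *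
    Real.Gamma (((t : ℝ) + 1) / 2 - x / 2) / (Real.pi * (Nat.factorial t : ℝ))

theorem kt_factor (b x : ℝ) (hx : 0 ≤ x) (hb : x < b) :
    (b + x) * (b - x) * Real.exp (x ^ 2 * (1 / b - 1 / (b + 1))) ≤ b ^ 2 := by
  have hb0 : 0 < b := by linarith
  have h1 : x ^ 2 * (1 / b - 1 / (b + 1)) ≤ x ^ 2 / b ^ 2 := by
    rw [div_eq_mul_one_div (x ^ 2) (b ^ 2)]
    apply mul_le_mul_of_nonneg_left _ (sq_nonneg x)
    rw [div_sub_div _ _ hb0.ne' (by linarith), div_le_div_iff₀ (by positivity) (by positivity)]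
    nlinarith
  have h2 : 1 - x ^ 2 / b ^ 2 ≤ Real.exp (-(x ^ 2 / b ^ 2)) := Real.one_sub_le_exp_neg _
  have h3 : (b + x) * (b - x) = b ^ 2 * (1 - x ^ 2 / b ^ 2) := by
    field_simp
    ring
  calc (b + x) * (b - x) * Real.exp (x ^ 2 * (1 / b - 1 / (b + 1)))
      ≤ (b ^ 2 * Real.exp (-(x ^ 2 / b ^ 2))) * Real.exp (x ^ 2 / b ^ 2) := by
        apply mul_le_mul _ (Real.exp_le_exp.2 h1) (Real.exp_pos _).le (by positivity)
        rw [h3]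
        exact mul_le_mul_of_nonneg_left h2 (by positivity)
    _ = b ^ 2 := by
        rw [mul_assoc, ← Real.exp_add]
        simp

theorem kt_prod (a x : ℝ) (hx : 0 ≤ x) (ha : x < a) (n : ℕ) :
    (∏ j ∈ Finset.range n, (a + x + j)) * (∏ j ∈ Finset.range n, (a - x + j)) *
      Real.exp (x ^ 2 * (1 / a - 1 / (a + n))) ≤ (∏ j ∈ Finset.range n, (a + j)) ^ 2 := by
  induction n with
  | zero => simp
  | succ n ih =>
    have hn : (0 : ℝ) ≤ n := Nat.cast_nonneg n
    have hf := kt_factor (a + n) x hx (by linarith)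
    rw [Finset.prod_range_succ, Finset.prod_range_succ, Finset.prod_range_succ]
    have he : Real.exp (x ^ 2 * (1 / a - 1 / (a + ((n + 1 : ℕ) : ℝ)))) =
        Real.exp (x ^ 2 * (1 / a - 1 / (a + n))) *
        Real.exp (x ^ 2 * (1 / (a + n) - 1 / (a + n + 1))) := by
      rw [← Real.exp_add]
      congr 1
      push_cast
      ring
    rw [he]
    have hpos : 0 ≤ (a + n + x) * (a + n - x) *
        Real.exp (x ^ 2 * (1 / (a + n) - 1 / (a + n + 1))) := by
      have : 0 ≤ a + n - x := by linarith
      have : 0 ≤ a + n + x := by linarith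
      positivity
    have := mul_le_mul ih hf hpos (sq_nonneg _)
    calc _ = _ := ?_
      _ ≤ _ := this
      _ = _ := by ring
    ring

theorem kt_seq (a x : ℝ) (hx : 0 ≤ x) (ha : x < a) (n : ℕ) (hn : 0 < n) :
    Real.GammaSeq a n ^ 2 * Real.exp (x ^ 2 * (1 / a - 1 / (a + ((n + 1 : ℕ) : ℝ)))) ≤
      Real.GammaSeq (a + x) n * Real.GammaSeq (a - x) n := by
  have h := kt_prod a x hx ha (n + 1)
  unfold Real.GammaSeq
  have hp : ∀ c : ℝ, 0 < c → 0 < ∏ j ∈ Finset.range (n + 1), (c + (j : ℝ)) := fun c hc =>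
    Finset.prod_pos fun j _ => by positivity
  have h1 := hp a (by linarith)
  have h2 := hp (a + x) (by linarith)
  have h3 := hp (a - x) (by linarith)
  have hn' : (0 : ℝ) < n := by exact_mod_cast hn
  have hpow : (n : ℝ) ^ (a + x) * (n : ℝ) ^ (a - x) = ((n : ℝ) ^ a) ^ 2 := by
    rw [← Real.rpow_add hn', sq, ← Real.rpow_add hn']
    congr 1
    ring
  rw [div_mul_div_comm, div_pow, div_mul_eq_mul_div, div_le_div_iff₀ (by positivity) (by positivity)]
  have hC : 0 ≤ ((n : ℝ) ^ a) ^ 2 * (Nat.factorial n : ℝ) ^ 2 := by positivity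
  have := mul_le_mul_of_nonneg_left h hC
  calc _ = _ := ?_
    _ ≤ _ := this
    _ = _ := ?_
  · ring
  · rw [← hpow]
    ring

theorem kt_gamma (a x : ℝ) (hx : 0 ≤ x) (ha : x < a) :
    Real.Gamma a ^ 2 * Real.exp (x ^ 2 / a) ≤ Real.Gamma (a + x) * Real.Gamma (a - x) := by
  have hlim : Filter.Tendsto (fun n : ℕ => 1 / (a + ((n + 1 : ℕ) : ℝ))) Filter.atTop (nhds 0) := by
    apply Filter.Tendsto.div_atTop tendsto_const_nhds
    apply Filter.tendsto_atTop_add_const_left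
    exact tendsto_natCast_atTop_atTop.comp (Filter.tendsto_add_atTop_nat 1)
  have hl : Filter.Tendsto (fun n : ℕ => Real.GammaSeq a n ^ 2 *
      Real.exp (x ^ 2 * (1 / a - 1 / (a + ((n + 1 : ℕ) : ℝ))))) Filter.atTop
      (nhds (Real.Gamma a ^ 2 * Real.exp (x ^ 2 * (1 / a - 0)))) :=
    ((Real.GammaSeq_tendsto_Gamma a).pow 2).mul
      ((Real.continuous_exp.tendsto _).comp ((tendsto_const_nhds.sub hlim).const_mul (x ^ 2)))
  have hr := (Real.GammaSeq_tendsto_Gamma (a + x)).mul (Real.GammaSeq_tendsto_Gamma (a - x))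
  have := le_of_tendsto_of_tendsto hl hr (by
    filter_upwards [Filter.eventually_gt_atTop 0] with n hn
    exact kt_seq a x hx ha n hn)
  rwa [sub_zero, mul_one_div] at this

theorem kt_half (y : ℝ) (hy : 0 < y) :
    Real.Gamma (y + 1 / 2) ≤ Real.Gamma y * Real.sqrt y := by
  have h := Real.Gamma_mul_add_mul_le_rpow_Gamma_mul_rpow_Gamma (s := y) (t := y + 1)
    (a := 1 / 2) (b := 1 / 2) hy (by linarith) (by norm_num) (by norm_num) (by norm_num)
  rw [← Real.sqrt_eq_rpow, ← Real.sqrt_eq_rpow, Real.Gamma_add_one hy.ne'] at h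
  have hG := Real.Gamma_pos_of_pos hy
  calc Real.Gamma (y + 1 / 2) = Real.Gamma (1 / 2 * y + 1 / 2 * (y + 1)) := by
        congr 1
        ring
    _ ≤ _ := h
    _ = Real.Gamma y * Real.sqrt y := by
        rw [Real.sqrt_mul hy.le, mul_comm (Real.sqrt y), ← mul_assoc, Real.mul_self_sqrt hG.le]

theorem kt_center (T : ℕ) (hT : 1 ≤ T) :
    1 / (Real.exp 1 * Real.sqrt (Real.pi * (T : ℝ))) ≤
      2 ^ T * Real.Gamma (((T : ℝ) + 1) / 2) ^ 2 / (Real.pi * (Nat.factorial T : ℝ)) := by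
  have hT' : (1 : ℝ) ≤ T := by exact_mod_cast hT
  set y : ℝ := ((T : ℝ) + 1) / 2 with hy
  have hy0 : 0 < y := by positivity
  have hG := Real.Gamma_pos_of_pos hy0
  have hG2 : 0 < Real.Gamma (y + 1 / 2) := Real.Gamma_pos_of_pos (by positivity)
  have hd := Real.Gamma_mul_Gamma_add_half y
  have e1 : 2 * y = (T : ℝ) + 1 := by rw [hy]; ring
  rw [e1, Real.Gamma_nat_eq_factorial, show (1 : ℝ) - ((T : ℝ) + 1) = -(T : ℝ) by ring,
    Real.rpow_neg (by norm_num), Real.rpow_natCast] at hd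
  have hf : (Nat.factorial T : ℝ) =
      2 ^ T * (Real.Gamma y * Real.Gamma (y + 1 / 2)) / Real.sqrt Real.pi := by
    have : 0 < Real.sqrt Real.pi := Real.sqrt_pos.2 Real.pi_pos
    rw [hd]
    field_simp
  have hspi : 0 < Real.sqrt Real.pi := Real.sqrt_pos.2 Real.pi_pos
  have hsq : Real.sqrt Real.pi * Real.sqrt Real.pi = Real.pi :=
    Real.mul_self_sqrt Real.pi_pos.le
  have hval : 2 ^ T * Real.Gamma y ^ 2 / (Real.pi * (Nat.factorial T : ℝ)) =
      Real.Gamma y / (Real.sqrt Real.pi * Real.Gamma (y + 1 / 2)) := by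
    rw [hf]
    nth_rewrite 1 [← hsq]
    field_simp
  rw [hval, Real.sqrt_mul Real.pi_pos.le, div_le_div_iff₀ (by positivity) (by positivity), one_mul]
  have hk := kt_half y hy0
  have hs : Real.sqrt y ≤ Real.exp 1 * Real.sqrt T := by
    have h1 : Real.sqrt y ≤ Real.sqrt T := Real.sqrt_le_sqrt (by rw [hy]; linarith)
    have h2 : (1 : ℝ) ≤ Real.exp 1 := Real.one_le_exp (by norm_num)
    nlinarith [Real.sqrt_nonneg (T : ℝ)]
  calc Real.sqrt Real.pi * Real.Gamma (y + 1 / 2)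
      ≤ Real.sqrt Real.pi * (Real.Gamma y * (Real.exp 1 * Real.sqrt T)) := by gcongr; exact hk.trans (by gcongr)
    _ = _ := by ring

theorem kt_lower (ε : ℝ) (hε : 0 < ε) (T : ℕ) (hT : 1 ≤ T) (s : ℝ) (hs : 0 ≤ s) (hsT : s ≤ T) :
    ε / (Real.exp 1 * Real.sqrt (Real.pi * (T : ℝ))) * Real.exp (s ^ 2 / (2 * ((T : ℝ) + 1))) ≤
      FKT ε T s := by
  have h1 := kt_gamma (((T : ℝ) + 1) / 2) (s / 2) (by linarith) (by linarith)
  have h2 := kt_center T hT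
  have e : (s / 2) ^ 2 / (((T : ℝ) + 1) / 2) = s ^ 2 / (2 * ((T : ℝ) + 1)) := by
    field_simp
  rw [e] at h1
  unfold FKT
  set E := Real.exp (s ^ 2 / (2 * ((T : ℝ) + 1)))
  have hE : 0 < E := Real.exp_pos _
  set c := Real.exp 1 * Real.sqrt (Real.pi * (T : ℝ))
  have hD : 0 < Real.pi * (Nat.factorial T : ℝ) := by positivity
  calc ε / c * E = ε * (1 / c) * E := by ring
    _ ≤ ε * (2 ^ T * Real.Gamma (((T : ℝ) + 1) / 2) ^ 2 / (Real.pi * (Nat.factorial T : ℝ))) * E := by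
        gcongr
    _ = ε * 2 ^ T * (Real.Gamma (((T : ℝ) + 1) / 2) ^ 2 * E) / (Real.pi * (Nat.factorial T : ℝ)) := by
        ring
    _ ≤ ε * 2 ^ T * (Real.Gamma (((T : ℝ) + 1) / 2 + s / 2) *
          Real.Gamma (((T : ℝ) + 1) / 2 - s / 2)) / (Real.pi * (Nat.factorial T : ℝ)) := by
        gcongr
    _ = _ := by ring

theorem kt_conj (c A θ s : ℝ) (hc : 0 < c) (hA : 0 < A) (hθ : 0 ≤ θ) (hs : 0 ≤ s) :
    θ * s - c * Real.exp (s ^ 2 / A) ≤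
      θ * Real.sqrt (A * Real.log (1 + A * θ ^ 2 / c ^ 2)) - c := by
  have hexp := Real.add_one_le_exp (s ^ 2 / A)
  have hu : 0 ≤ s ^ 2 / A := by positivity
  rcases le_total (s ^ 2) (A * Real.log (1 + A * θ ^ 2 / c ^ 2)) with h | h
  · have h1 := mul_le_mul_of_nonneg_left (Real.le_sqrt_of_sq_le h) hθ
    nlinarith
  · have h0 : 0 < 1 + A * θ ^ 2 / c ^ 2 := by positivity
    have h1 : 1 + A * θ ^ 2 / c ^ 2 ≤ Real.exp (s ^ 2 / A) := by
      rw [← Real.log_le_iff_le_exp h0, le_div_iff₀ hA]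
      linarith
    set w := Real.exp (s ^ 2 / A) - 1 with hw
    have h2 : A * θ ^ 2 ≤ w * c ^ 2 := by
      rw [← div_le_iff₀ (by positivity)]
      linarith
    have h3 : s ^ 2 ≤ w * A := by
      rw [← div_le_iff₀ hA]
      linarith
    have hw0 : 0 ≤ w := by linarith
    have h4 : θ * s ≤ c * w := by
      refine (fun h0 h1 => (abs_le_of_sq_le_sq' h0 h1).2) ?_ (by positivity)
      have := mul_le_mul h2 h3 (sq_nonneg s) (by positivity)
      have h5 : A * (θ * s) ^ 2 ≤ A * (c * w) ^ 2 := by nlinarith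
      exact le_of_mul_le_mul_left h5 hA
    have h6 := mul_nonneg hθ (Real.sqrt_nonneg (A * Real.log (1 + A * θ ^ 2 / c ^ 2)))
    rw [show Real.exp (s ^ 2 / A) = w + 1 by rw [hw]; ring]
    linarith



/-- Restricted terminal Fenchel conjugate envelope for the KT potential:
sup_{0 ≤ s ≤ T} (θ·s − F_T^{KT}(s))
  ≤ θ·√(2(T+1)·log(1 + 2e²πT(T+1)θ²/ε²)) − ε/(e·√(πT)). -/
theorem kt_restricted_conjugate_envelope (ε : ℝ) (hε : 0 < ε) (T : ℕ) (hT : 1 ≤ T)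
    (θ : ℝ) (hθ : 0 ≤ θ) :
    sSup ((fun s : ℝ => θ * s - FKT ε T s) '' Set.Icc (0 : ℝ) (T : ℝ)) ≤
      θ * Real.sqrt (2 * ((T : ℝ) + 1) *
          Real.log (1 + 2 * Real.exp 1 ^ 2 * Real.pi * (T : ℝ) * ((T : ℝ) + 1) * θ ^ 2 / ε ^ 2))
        - ε / (Real.exp 1 * Real.sqrt (Real.pi * (T : ℝ))) := by
  have hT' : (1 : ℝ) ≤ T := by exact_mod_cast hT
  apply csSup_le
  · exact Set.Nonempty.image _ ⟨0, by simp⟩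
  rintro _ ⟨s, ⟨hs, hsT⟩, rfl⟩
  have h1 := kt_lower ε hε T hT s hs hsT
  have hT0 : (0 : ℝ) < T := by linarith
  have hc : 0 < ε / (Real.exp 1 * Real.sqrt (Real.pi * (T : ℝ))) := by positivity
  have h2 := kt_conj _ (2 * ((T : ℝ) + 1)) θ s hc (by positivity) hθ hs
  have e : 2 * ((T : ℝ) + 1) * θ ^ 2 / (ε / (Real.exp 1 * Real.sqrt (Real.pi * (T : ℝ)))) ^ 2 =
      2 * Real.exp 1 ^ 2 * Real.pi * (T : ℝ) * ((T : ℝ) + 1) * θ ^ 2 / ε ^ 2 := by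
    rw [div_pow, mul_pow, Real.sq_sqrt (by positivity)]
    field_simp
  rw [e] at h2
  dsimp only
  linarith
end

section
/- Let ε > 0, let T ≥ 1 be an integer, and let θ ≥ 0 be real. Then sup over real s with 0 ≤ s ≤ T of (θ·s − (ε/√(T+1))·exp(s²/(2(T+1)))) is at most θ·√((T+1)·log(1 + (T+1)²·θ²/ε²)) − ε/√(T+1). -/
theorem se_scalar_aux (a u : ℝ) (ha : 0 ≤ a) :
    a * u - Real.exp (u ^ 2 / 2) ≤ a * Real.sqrt (Real.log (1 + a ^ 2)) - 1 := by
  have hpos : (0 : ℝ) < 1 + a ^ 2 := by positivity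
  have hlog0 : 0 ≤ Real.log (1 + a ^ 2) := Real.log_nonneg (by nlinarith)
  set L := Real.sqrt (Real.log (1 + a ^ 2)) with hL
  have hL0 : 0 ≤ L := Real.sqrt_nonneg _
  have hL2 : L ^ 2 = Real.log (1 + a ^ 2) := Real.sq_sqrt hlog0
  have hE : u ^ 2 / 2 + 1 ≤ Real.exp (u ^ 2 / 2) := Real.add_one_le_exp _
  rcases le_total (a ^ 2) 3 with h3 | h3
  · have h1 : 1 - (1 + a ^ 2)⁻¹ ≤ Real.log (1 + a ^ 2) := Real.one_sub_inv_le_log_of_pos hpos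
    have h2 : a ^ 2 / 4 ≤ 1 - (1 + a ^ 2)⁻¹ := by
      have : 1 - (1 + a ^ 2)⁻¹ = a ^ 2 / (1 + a ^ 2) := by field_simp; ring
      rw [this]
      apply div_le_div_of_nonneg_left <;> nlinarith
    have h4 : a / 2 ≤ L := Real.le_sqrt_of_sq_le (by nlinarith)
    nlinarith [sq_nonneg (u - a), mul_le_mul_of_nonneg_left h4 ha]
  · have ha1 : 1 ≤ a := by nlinarith
    rcases le_total u L with hu | hu
    · nlinarith [mul_le_mul_of_nonneg_left hu ha, sq_nonneg u]
    · have hL1 : 1 ≤ L := by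
        apply Real.le_sqrt_of_sq_le
        rw [Real.le_log_iff_exp_le hpos]
        have := Real.exp_one_lt_d9
        norm_num
        linarith
      have he0 : a ≤ Real.exp (L ^ 2 / 2) := by
        have hsq : Real.exp (L ^ 2 / 2) ^ 2 = 1 + a ^ 2 := by
          rw [← Real.exp_nat_mul, ← Real.exp_log hpos, ← hL2]
          congr 1
          push_cast
          ring
        exact abs_le_of_sq_le_sq' (by linarith) (Real.exp_pos _).le |>.2
      have he1 : Real.exp (u ^ 2 / 2) =
          Real.exp (L ^ 2 / 2) * Real.exp ((u ^ 2 - L ^ 2) / 2) := by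
        rw [← Real.exp_add]; congr 1; ring
      have he2 : 1 + (u - L) ≤ Real.exp ((u ^ 2 - L ^ 2) / 2) := by
        have := Real.add_one_le_exp ((u ^ 2 - L ^ 2) / 2)
        nlinarith
      have he3 : a * (1 + (u - L)) ≤ Real.exp (u ^ 2 / 2) := by
        rw [he1]
        exact mul_le_mul he0 he2 (by linarith) (Real.exp_pos _).le
      nlinarith

/-- Restricted terminal Fenchel conjugate envelope for the shifted-exponential potential:
sup_{0 ≤ s ≤ T} (θ·s − (ε/√(T+1))·exp(s²/(2(T+1))))
  ≤ θ·√((T+1)·log(1 + (T+1)²θ²/ε²)) − ε/√(T+1). -/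
theorem se_restricted_conjugate_envelope (ε : ℝ) (hε : 0 < ε) (T : ℕ) (hT : 1 ≤ T)
    (θ : ℝ) (hθ : 0 ≤ θ) :
    sSup ((fun s : ℝ =>
        θ * s - ε / Real.sqrt ((T : ℝ) + 1) * Real.exp (s ^ 2 / (2 * ((T : ℝ) + 1))))
      '' Set.Icc (0 : ℝ) (T : ℝ)) ≤
      θ * Real.sqrt (((T : ℝ) + 1) * Real.log (1 + ((T : ℝ) + 1) ^ 2 * θ ^ 2 / ε ^ 2))
        - ε / Real.sqrt ((T : ℝ) + 1) := by
  apply csSup_le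
  · exact ⟨_, 0, ⟨le_refl _, Nat.cast_nonneg T⟩, rfl⟩
  rintro _ ⟨s, -, rfl⟩
  beta_reduce
  have hn : (0 : ℝ) < (T : ℝ) + 1 := by positivity
  generalize (T : ℝ) + 1 = n at hn ⊢
  have hr : 0 < Real.sqrt n := Real.sqrt_pos.mpr hn
  have hr2 : Real.sqrt n ^ 2 = n := Real.sq_sqrt hn.le
  have key := se_scalar_aux (n * θ / ε) (s / Real.sqrt n) (by positivity)
  rw [Real.sqrt_mul hn.le]
  have e1 : (s / Real.sqrt n) ^ 2 / 2 = s ^ 2 / (2 * n) := by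
    rw [div_pow, hr2]; field_simp
  have e2 : (n * θ / ε) ^ 2 = n ^ 2 * θ ^ 2 / ε ^ 2 := by ring
  rw [e1, e2] at key
  have key2 := mul_le_mul_of_nonneg_left key (div_pos hε hr).le
  generalize Real.exp (s ^ 2 / (2 * n)) = E at key2 ⊢
  generalize Real.sqrt (Real.log (1 + n ^ 2 * θ ^ 2 / ε ^ 2)) = L at key2 ⊢
  generalize Real.sqrt n = r at *
  subst hr2
  have f1 : ε / r * (r ^ 2 * θ / ε * (s / r) - E) = θ * s - ε / r * E := by
    field_simp
  have f2 : ε / r * (r ^ 2 * θ / ε * L - 1) = θ * (r * L) - ε / r := by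
    field_simp
  linarith
end

section
/- Let q : ℕ → ℕ, let P ≥ 0 and η ≥ 0 be real numbers, and define Q(s,t) = Σ_{r=s}^{t−1} q(r) for integers 0 ≤ s ≤ t. Let a : ℕ → ℝ satisfy a(0) = 0 and a(t+1) ≤ η^{q(t)} · (a(t) + P) for every integer t ≥ 0. Then for every integer t ≥ 0, a(t) ≤ P · Σ_{s=0}^{t−1} η^{Q(s,t)}. -/
/-- Lyapunov tail unrolling: if a(0) = 0 and a(t+1) ≤ η^{q(t)}·(a(t) + P), then
a(t) ≤ P·Σ_{s<t} η^{Q(s,t)} where Q(s,t) = Σ_{r=s}^{t−1} q(r). -/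
theorem lyapunov_tail_unrolling (q : ℕ → ℕ) (P η : ℝ) (hP : 0 ≤ P) (hη : 0 ≤ η)
    (a : ℕ → ℝ) (ha0 : a 0 = 0)
    (hrec : ∀ t : ℕ, a (t + 1) ≤ η ^ (q t) * (a t + P)) :
    ∀ t : ℕ, a t ≤ P * ∑ s ∈ Finset.range t, η ^ (∑ r ∈ Finset.Ico s t, q r) := by
  intro t
  induction t with
  | zero => simp [ha0]
  | succ t ih =>
    have key : ∑ s ∈ Finset.range (t + 1), η ^ (∑ r ∈ Finset.Ico s (t + 1), q r)
        = η ^ (q t) * (∑ s ∈ Finset.range t, η ^ (∑ r ∈ Finset.Ico s t, q r)) + η ^ (q t) := by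
      rw [Finset.sum_range_succ, Finset.mul_sum]
      congr 1
      · apply Finset.sum_congr rfl
        intro s hs
        rw [Finset.sum_Ico_succ_top (Finset.mem_range.mp hs).le, pow_add, mul_comm]
      · simp
    have h1 : η ^ (q t) * (a t + P) ≤ η ^ (q t) *
        (P * ∑ s ∈ Finset.range t, η ^ (∑ r ∈ Finset.Ico s t, q r) + P) :=
      mul_le_mul_of_nonneg_left (by linarith) (pow_nonneg hη _)
    calc a (t + 1) ≤ _ := hrec t
      _ ≤ _ := h1
      _ = _ := by rw [key]; ring
end

section
/- Let H be a real Hilbert space, let R > 0 and A ≥ 0 be real numbers, and let h : ℝ → ℝ be continuous on [0,R], differentiable on (0,R) with |h′(r)| ≤ A for all r ∈ (0,R), and satisfy |h(r)| ≤ A·r for all r ∈ (0,R]. Define H̃ : H → H by H̃(0) = 0 and H̃(G) = (h(‖G‖)/‖G‖)·G for G ≠ 0. Then ‖H̃(a) − H̃(b)‖ ≤ A·‖a − b‖ for all a, b ∈ H with ‖a‖ ≤ R and ‖b‖ ≤ R. Moreover, the map G ↦ H̃(clip_R(G)) is A-Lipschitz on all of H, where clip_R(G) = G if ‖G‖ ≤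 R and clip_R(G) = (R/‖G‖)·G otherwise. -/
theorem radial_core {H : Type*} [NormedAddCommGroup H] [InnerProductSpace ℝ H]
    (a b : H) (p q B : ℝ) (hB : 0 ≤ B) (hp : |p| ≤ B) (hq : |q| ≤ B)
    (hpq : |p * ‖a‖ - q * ‖b‖| ≤ B * |‖a‖ - ‖b‖|) :
    ‖p • a - q • b‖ ≤ B * ‖a - b‖ := by
  refine (sq_le_sq₀ (norm_nonneg _) (by positivity)).1 ?_
  have e1 : ‖p • a - q • b‖ ^ 2
      = (p * ‖a‖ - q * ‖b‖) ^ 2 + 2 * (p * q) * (‖a‖ * ‖b‖ - inner ℝ a b) := by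
    rw [norm_sub_sq_real, norm_smul, norm_smul, real_inner_smul_left, real_inner_smul_right,
      mul_pow, mul_pow, Real.norm_eq_abs, Real.norm_eq_abs, sq_abs, sq_abs]
    ring
  have e2 : ‖a - b‖ ^ 2 = (‖a‖ - ‖b‖) ^ 2 + 2 * (‖a‖ * ‖b‖ - inner ℝ a b) := by
    rw [norm_sub_sq_real]; ring
  have hc : 0 ≤ ‖a‖ * ‖b‖ - inner ℝ a b := sub_nonneg.2 (real_inner_le_norm a b)
  have h1 : (p * ‖a‖ - q * ‖b‖) ^ 2 ≤ B ^ 2 * (‖a‖ - ‖b‖) ^ 2 := by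
    have := pow_le_pow_left₀ (abs_nonneg _) hpq 2
    rwa [mul_pow, sq_abs, sq_abs] at this
  have h2 : p * q ≤ B ^ 2 := by
    calc p * q ≤ |p * q| := le_abs_self _
      _ = |p| * |q| := abs_mul _ _
      _ ≤ B * B := mul_le_mul hp hq (abs_nonneg _) hB
      _ = B ^ 2 := by ring
  have h3 := mul_le_mul_of_nonneg_right h2 hc
  rw [e1, mul_pow, e2]
  linarith

/-- Radial prediction Lipschitz envelope: if |h′| ≤ A on (0,R) and |h(r)| ≤ A·r, then the
radial map G ↦ (h(‖G‖)/‖G‖)·G is A-Lipschitz on the ball of radius R, and its composition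
with clipping to the ball is A-Lipschitz on all of H. -/
theorem radial_prediction_lipschitz_envelope
    {H : Type*} [NormedAddCommGroup H] [InnerProductSpace ℝ H] [CompleteSpace H]
    (R A : ℝ) (hR : 0 < R) (hA : 0 ≤ A) (h : ℝ → ℝ)
    (hcont : ContinuousOn h (Set.Icc 0 R))
    (hdiff : ∀ r ∈ Set.Ioo (0 : ℝ) R, DifferentiableAt ℝ h r)
    (hderiv : ∀ r ∈ Set.Ioo (0 : ℝ) R, |deriv h r| ≤ A)
    (hbound : ∀ r ∈ Set.Ioc (0 : ℝ) R, |h r| ≤ A * r)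
    (Htil : H → H) (hH0 : Htil 0 = 0)
    (hHdef : ∀ G : H, G ≠ 0 → Htil G = (h ‖G‖ / ‖G‖) • G)
    (clip : H → H)
    (hclip : ∀ G : H, clip G = if ‖G‖ ≤ R then G else (R / ‖G‖) • G) :
    (∀ a b : H, ‖a‖ ≤ R → ‖b‖ ≤ R → ‖Htil a - Htil b‖ ≤ A * ‖a - b‖) ∧
    (∀ a b : H, ‖Htil (clip a) - Htil (clip b)‖ ≤ A * ‖a - b‖) := by
  have hlip : ∀ r ∈ Set.Icc (0 : ℝ) R, ∀ s ∈ Set.Icc (0 : ℝ) R, r < s →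
      |h r - h s| ≤ A * |r - s| := by
    intro r hr s hs hrs
    obtain ⟨c, hc, hc'⟩ := exists_deriv_eq_slope h hrs
      (hcont.mono (Set.Icc_subset_Icc hr.1 hs.2))
      (fun x hx => (hdiff x ⟨hr.1.trans_lt hx.1, hx.2.trans_le hs.2⟩).differentiableWithinAt)
    have hd := hderiv c ⟨hr.1.trans_lt hc.1, hc.2.trans_le hs.2⟩
    have hsr : 0 < s - r := sub_pos.2 hrs
    rw [hc', abs_div, abs_of_pos hsr, div_le_iff₀ hsr] at hd
    rw [abs_sub_comm (h r), abs_sub_comm r, abs_of_pos hsr]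
    exact hd
  have hlip2 : ∀ r ∈ Set.Icc (0 : ℝ) R, ∀ s ∈ Set.Icc (0 : ℝ) R,
      |h r - h s| ≤ A * |r - s| := by
    intro r hr s hs
    rcases lt_trichotomy r s with hlt | heq | hgt
    · exact hlip r hr s hs hlt
    · simp [heq]
    · rw [abs_sub_comm (h r), abs_sub_comm r]
      exact hlip s hs r hr hgt
  have hquot : ∀ G : H, ‖G‖ ≤ R → G ≠ 0 → |h ‖G‖ / ‖G‖| ≤ A := by
    intro G hG hG0
    have hpos : 0 < ‖G‖ := norm_pos_iff.2 hG0
    rw [abs_div, abs_of_pos hpos, div_le_iff₀ hpos]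
    exact hbound _ ⟨hpos, hG⟩
  have hnorm : ∀ G : H, ‖G‖ ≤ R → ‖Htil G‖ ≤ A * ‖G‖ := by
    intro G hG
    by_cases hG0 : G = 0
    · simp [hG0, hH0]
    · rw [hHdef G hG0, norm_smul, Real.norm_eq_abs]
      exact mul_le_mul_of_nonneg_right (hquot G hG hG0) (norm_nonneg _)
  have part1 : ∀ a b : H, ‖a‖ ≤ R → ‖b‖ ≤ R → ‖Htil a - Htil b‖ ≤ A * ‖a - b‖ := by
    intro a b ha hb
    by_cases ha0 : a = 0
    · rw [ha0, hH0, zero_sub, zero_sub, norm_neg, norm_neg]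
      exact hnorm b hb
    by_cases hb0 : b = 0
    · rw [hb0, hH0, sub_zero, sub_zero]
      exact hnorm a ha
    rw [hHdef a ha0, hHdef b hb0]
    apply radial_core a b _ _ A hA (hquot a ha ha0) (hquot b hb hb0)
    rw [div_mul_cancel₀ _ (norm_ne_zero_iff.2 ha0), div_mul_cancel₀ _ (norm_ne_zero_iff.2 hb0)]
    exact hlip2 _ ⟨norm_nonneg _, ha⟩ _ ⟨norm_nonneg _, hb⟩
  have hcl : ∀ G : H, ∃ p : ℝ, clip G = p • G ∧ |p| ≤ 1 ∧ p * ‖G‖ = min ‖G‖ R := by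
    intro G
    by_cases hG : ‖G‖ ≤ R
    · exact ⟨1, by simp [hclip, hG], by simp, by simp [hG]⟩
    · have hG' : R < ‖G‖ := not_le.1 hG
      have hpos : 0 < ‖G‖ := hR.trans hG'
      refine ⟨R / ‖G‖, by simp [hclip, hG], ?_, ?_⟩
      · rw [abs_of_pos (div_pos hR hpos), div_le_one hpos]
        exact hG'.le
      · rw [div_mul_cancel₀ _ hpos.ne', min_eq_right hG'.le]
  have hclR : ∀ G : H, ‖clip G‖ ≤ R := by
    intro G
    obtain ⟨p, h1, -, h3⟩ := hcl G
    have : ‖clip G‖ = |p * ‖G‖| := by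
      rw [h1, norm_smul, Real.norm_eq_abs, abs_mul, abs_norm]
    rw [this, h3, abs_of_nonneg (le_min (norm_nonneg _) hR.le)]
    exact min_le_right _ _
  refine ⟨part1, fun a b => (part1 _ _ (hclR a) (hclR b)).trans ?_⟩
  apply mul_le_mul_of_nonneg_left _ hA
  obtain ⟨p, hp1, hp2, hp3⟩ := hcl a
  obtain ⟨q, hq1, hq2, hq3⟩ := hcl b
  rw [hp1, hq1, ← one_mul ‖a - b‖]
  apply radial_core a b p q 1 zero_le_one hp2 hq2
  rw [hp3, hq3, one_mul]
  simpa using abs_min_sub_min_le_max ‖a‖ R ‖b‖ R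
end

section
/- Let ε > 0, let t ≥ 1 be an integer, and let H be a real Hilbert space. Let F_s^{KT} be the KT potential with endowment ε, let β_{t+1}(x) = (F_{t+1}^{KT}(x+1) − F_{t+1}^{KT}(x−1))/(F_{t+1}^{KT}(x+1) + F_{t+1}^{KT}(x−1)), h_{t+1}(x) = β_{t+1}(x)·F_t^{KT}(x), define Bet_{t+1}(G) = (h_{t+1}(‖G‖)/‖G‖)·G for G ≠ 0 and Bet_{t+1}(0) = 0, clip_t(G) = G if ‖G‖ ≤ t and (t/‖G‖)·G otherwise, and B_t(G) = Bet_{t+1}(clip_t(G)). Then for all a, b ∈ H, ‖B_t(a) − B_t(b)‖ ≤ C · (2^t · log(t+2)/√(t+1)) · ‖a − b‖, where C = (ε+1)·(1 + 2/log 2) + 1. -/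
open Classical

/-- Betting fraction β_t of the KT potential. -/
noncomputable def betaKT (ε : ℝ) (t : ℕ) (x : ℝ) : ℝ :=
  (FKT ε t (x + 1) - FKT ε t (x - 1)) / (FKT ε t (x + 1) + FKT ε t (x - 1))

/-- KT coin-betting function h_{t+1}(x) = β_{t+1}(x)·F_t^{KT}(x). -/
noncomputable def hKT (ε : ℝ) (t : ℕ) (x : ℝ) : ℝ :=
  betaKT ε (t + 1) x * FKT ε t x

/-- Radial betting map Bet_{t+1}(G) = (h_{t+1}(‖G‖)/‖G‖)·G, Bet_{t+1}(0) = 0. -/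
noncomputable def BetKT {H : Type*} [NormedAddCommGroup H] [InnerProductSpace ℝ H]
    (ε : ℝ) (t : ℕ) (G : H) : H :=
  if G = 0 then 0 else (hKT ε t ‖G‖ / ‖G‖) • G

/-- Norm clipping to the closed ball of radius R. -/
noncomputable def clipR {H : Type*} [NormedAddCommGroup H] [InnerProductSpace ℝ H]
    (R : ℝ) (G : H) : H :=
  if ‖G‖ ≤ R then G else (R / ‖G‖) • G

lemma clip_obtuse {H : Type*} [NormedAddCommGroup H] [InnerProductSpace ℝ H]
    (R : ℝ) (hR : 0 ≤ R) (a z : H) (hz : ‖z‖ ≤ R) :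
    inner ℝ (a - clipR R a) (z - clipR R a) ≤ 0 := by
  unfold clipR
  split_ifs with h
  · simp
  · push Not at h
    have ha : 0 < ‖a‖ := lt_of_le_of_lt hR h
    have e : a - (R / ‖a‖) • a = (1 - R / ‖a‖) • a := by rw [sub_smul, one_smul]
    rw [e, real_inner_smul_left, inner_sub_right, real_inner_smul_right,
      real_inner_self_eq_norm_sq]
    have h1 : 0 ≤ 1 - R / ‖a‖ := by
      rw [sub_nonneg, div_le_one ha]; exact h.le
    have h2 : R / ‖a‖ * ‖a‖ ^ 2 = R * ‖a‖ := by field_simp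
    have h3 : inner ℝ a z ≤ ‖a‖ * ‖z‖ := real_inner_le_norm a z
    have h4 : ‖a‖ * ‖z‖ ≤ ‖a‖ * R := by gcongr
    rw [h2]
    exact mul_nonpos_of_nonneg_of_nonpos h1 (by linarith)

lemma clip_norm_le {H : Type*} [NormedAddCommGroup H] [InnerProductSpace ℝ H]
    (R : ℝ) (hR : 0 ≤ R) (a : H) : ‖clipR R a‖ ≤ R := by
  unfold clipR
  split_ifs with h
  · exact h
  · push Not at h
    have ha : 0 < ‖a‖ := lt_of_le_of_lt hR h
    rw [norm_smul, Real.norm_of_nonneg (by positivity), div_mul_cancel₀ _ ha.ne']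

lemma clip_lip {H : Type*} [NormedAddCommGroup H] [InnerProductSpace ℝ H]
    (R : ℝ) (hR : 0 ≤ R) (a b : H) : ‖clipR R a - clipR R b‖ ≤ ‖a - b‖ := by
  have h1 := clip_obtuse R hR a (clipR R b) (clip_norm_le R hR b)
  have h2 := clip_obtuse R hR b (clipR R a) (clip_norm_le R hR a)
  set p := clipR R a
  set q := clipR R b
  have h3 : ‖p - q‖ * ‖p - q‖ ≤ ‖a - b‖ * ‖p - q‖ := by
    refine le_trans ?_ (real_inner_le_norm (a - b) (p - q))
    rw [← real_inner_self_eq_norm_mul_norm]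
    have : inner ℝ (a - b) (p - q) - inner ℝ (p - q) (p - q)
        = -(inner ℝ (a - p) (q - p) + inner ℝ (b - q) (p - q)) := by
      simp only [inner_sub_left, inner_sub_right]
      ring
    linarith
  by_cases h : ‖p - q‖ = 0
  · rw [h]; positivity
  · exact le_of_mul_le_mul_right h3 (lt_of_le_of_ne (norm_nonneg _) (Ne.symm h))

lemma beta_eq (ε : ℝ) (hε : 0 < ε) (t : ℕ) (x : ℝ) (hx : 0 ≤ x) (hxt : x ≤ t) :
    betaKT ε (t + 1) x = x / (t + 1) := by
  have hA : (0:ℝ) < (t + 1) / 2 + x / 2 := by positivity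
  have hB : (0:ℝ) < (t + 1) / 2 - x / 2 := by linarith
  have hGA := Real.Gamma_pos_of_pos hA
  have hGB := Real.Gamma_pos_of_pos hB
  have ht : (0:ℝ) < (t:ℝ) + 1 := by positivity
  set K : ℝ := ε * 2 ^ (t + 1) / (Real.pi * (Nat.factorial (t + 1) : ℝ)) with hK
  have hKpos : 0 < K := by have := Real.pi_pos; positivity
  have e1 : FKT ε (t + 1) (x + 1) = K * (Real.Gamma ((t + 1) / 2 + x / 2) *
      Real.Gamma ((t + 1) / 2 - x / 2)) * ((t + 1) / 2 + x / 2) := by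
    unfold FKT
    have a1 : (((t + 1 : ℕ) : ℝ) + 1) / 2 + (x + 1) / 2 = ((t + 1) / 2 + x / 2) + 1 := by
      push_cast; ring
    have a2 : (((t + 1 : ℕ) : ℝ) + 1) / 2 - (x + 1) / 2 = ((t + 1) / 2 - x / 2) := by
      push_cast; ring
    rw [a1, a2, Real.Gamma_add_one hA.ne', hK]; ring
  have e2 : FKT ε (t + 1) (x - 1) = K * (Real.Gamma ((t + 1) / 2 + x / 2) *
      Real.Gamma ((t + 1) / 2 - x / 2)) * ((t + 1) / 2 - x / 2) := by
    unfold FKT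
    have a1 : (((t + 1 : ℕ) : ℝ) + 1) / 2 + (x - 1) / 2 = ((t + 1) / 2 + x / 2) := by
      push_cast; ring
    have a2 : (((t + 1 : ℕ) : ℝ) + 1) / 2 - (x - 1) / 2 = ((t + 1) / 2 - x / 2) + 1 := by
      push_cast; ring
    rw [a1, a2, Real.Gamma_add_one hB.ne', hK]; ring
  unfold betaKT
  rw [e1, e2, ← mul_sub, ← mul_add, mul_div_mul_left _ _ (by positivity)]
  congr 1 <;> ring

lemma bet_eq {H : Type*} [NormedAddCommGroup H] [InnerProductSpace ℝ H]
    (ε : ℝ) (hε : 0 < ε) (t : ℕ) (G : H) (hG : ‖G‖ ≤ t) :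
    BetKT ε t G = (FKT ε t ‖G‖ / (t + 1)) • G := by
  unfold BetKT
  split_ifs with h
  · simp [h]
  · have : ‖G‖ ≠ 0 := by simpa using h
    unfold hKT
    rw [beta_eq ε hε t _ (norm_nonneg _) hG]
    congr 1
    field_simp

lemma FKT_pos (ε : ℝ) (hε : 0 < ε) (t : ℕ) (x : ℝ) (hx : x ∈ Set.Ioo (-(t + 1 : ℝ)) (t + 1)) :
    0 < FKT ε t x := by
  obtain ⟨h1, h2⟩ := hx
  have hGA := Real.Gamma_pos_of_pos (show (0:ℝ) < (t + 1) / 2 + x / 2 by linarith)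
  have hGB := Real.Gamma_pos_of_pos (show (0:ℝ) < (t + 1) / 2 - x / 2 by linarith)
  have := Real.pi_pos
  unfold FKT
  positivity

lemma FKT_even (ε : ℝ) (t : ℕ) (x : ℝ) : FKT ε t (-x) = FKT ε t x := by
  unfold FKT
  rw [neg_div, sub_neg_eq_add, ← sub_eq_add_neg]
  ring

lemma FKT_convex (ε : ℝ) (hε : 0 < ε) (t : ℕ) :
    ConvexOn ℝ (Set.Ioo (-(t + 1 : ℝ)) (t + 1)) (FKT ε t) := by
  have hcA : ConvexOn ℝ (Set.Ioo (-(t + 1 : ℝ)) (t + 1))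
      (fun x => Real.log (Real.Gamma ((t + 1) / 2 + x / 2))) := by
    refine ⟨convex_Ioo _ _, ?_⟩
    rintro x ⟨hx1, hx2⟩ y ⟨hy1, hy2⟩ a b ha hb hab
    have := Real.convexOn_log_Gamma.2 (x := (t + 1) / 2 + x / 2) (y := (t + 1) / 2 + y / 2)
      (by simp only [Set.mem_Ioi]; linarith) (by simp only [Set.mem_Ioi]; linarith) ha hb hab
    convert this using 3
    simp only [smul_eq_mul]
    congr 2
    linear_combination (-((t:ℝ) + 1) / 2) * hab
    all_goals rfl
  have hcB : ConvexOn ℝ (Set.Ioo (-(t + 1 : ℝ)) (t + 1))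
      (fun x => Real.log (Real.Gamma ((t + 1) / 2 - x / 2))) := by
    refine ⟨convex_Ioo _ _, ?_⟩
    rintro x ⟨hx1, hx2⟩ y ⟨hy1, hy2⟩ a b ha hb hab
    have := Real.convexOn_log_Gamma.2 (x := (t + 1) / 2 - x / 2) (y := (t + 1) / 2 - y / 2)
      (by simp only [Set.mem_Ioi]; linarith) (by simp only [Set.mem_Ioi]; linarith) ha hb hab
    convert this using 3
    simp only [smul_eq_mul]
    congr 2
    linear_combination (-((t:ℝ) + 1) / 2) * hab
    all_goals rfl
  set K : ℝ := ε * 2 ^ t / (Real.pi * (Nat.factorial t : ℝ)) with hK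
  have hKpos : 0 < K := by have := Real.pi_pos; positivity
  have hs := hcA.add hcB
  have he : ∀ x ∈ Set.Ioo (-(t + 1 : ℝ)) (t + 1), FKT ε t x = K * Real.exp
      (Real.log (Real.Gamma ((t + 1) / 2 + x / 2)) +
        Real.log (Real.Gamma ((t + 1) / 2 - x / 2))) := by
    rintro x ⟨h1, h2⟩
    have hGA := Real.Gamma_pos_of_pos (show (0:ℝ) < (t + 1) / 2 + x / 2 by linarith)
    have hGB := Real.Gamma_pos_of_pos (show (0:ℝ) < (t + 1) / 2 - x / 2 by linarith)
    rw [Real.exp_add, Real.exp_log hGA, Real.exp_log hGB, hK]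
    unfold FKT
    ring
  refine ⟨convex_Ioo _ _, ?_⟩
  intro x hx y hy a b ha hb hab
  rw [he _ hx, he _ hy, he _ (convex_Ioo _ _ hx hy ha hb hab)]
  have h1 := hs.2 hx hy ha hb hab
  have h2 := convexOn_exp.2 (Set.mem_univ (Real.log (Real.Gamma ((t + 1) / 2 + x / 2)) +
        Real.log (Real.Gamma ((t + 1) / 2 - x / 2))))
      (Set.mem_univ (Real.log (Real.Gamma ((t + 1) / 2 + y / 2)) +
        Real.log (Real.Gamma ((t + 1) / 2 - y / 2)))) ha hb hab
  have h3 := (Real.exp_le_exp.2 h1).trans h2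
  simp only [smul_eq_mul, Pi.add_apply] at h3 ⊢
  nlinarith [mul_le_mul_of_nonneg_left h3 hKpos.le]

lemma FKT_mono (ε : ℝ) (hε : 0 < ε) (t : ℕ) (x y : ℝ) (hy : 0 ≤ y) (hyx : y ≤ x) (hx : x ≤ t) :
    FKT ε t y ≤ FKT ε t x := by
  rcases eq_or_lt_of_le (hy.trans hyx) with h | h
  · have : y = x := by linarith
    rw [this]
  have m1 : x ∈ Set.Ioo (-(t + 1 : ℝ)) (t + 1) := ⟨by linarith, by linarith⟩
  have m2 : -x ∈ Set.Ioo (-(t + 1 : ℝ)) (t + 1) := ⟨by linarith, by linarith⟩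
  have w1 : 0 ≤ (x + y) / (2 * x) := by positivity
  have w2 : 0 ≤ (x - y) / (2 * x) := div_nonneg (by linarith) (by linarith)
  have w3 : (x + y) / (2 * x) + (x - y) / (2 * x) = 1 := by field_simp; ring
  have hc := (FKT_convex ε hε t).2 m1 m2 w1 w2 w3
  rw [FKT_even] at hc
  simp only [smul_eq_mul] at hc
  have e1 : (x + y) / (2 * x) * x + (x - y) / (2 * x) * -x = y := by field_simp; ring
  have e2 : (x + y) / (2 * x) * FKT ε t x + (x - y) / (2 * x) * FKT ε t x = FKT ε t x := by
    field_simp; ring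
  rwa [e1, e2] at hc

lemma Gamma_diff (s : ℝ) (hs : 0 < s) : DifferentiableAt ℝ Real.Gamma s :=
  Real.differentiableAt_Gamma (fun m => by have : (0:ℝ) ≤ m := m.cast_nonneg; linarith)

lemma Gamma_half_deriv (t : ℕ) :
    HasDerivAt Real.Gamma (Real.Gamma (t + 1 / 2) * (deriv Real.Gamma (1 / 2) / Real.Gamma (1 / 2)
      + 2 * ∑ k ∈ Finset.range t, 1 / (2 * (k : ℝ) + 1))) (t + 1 / 2) := by
  induction t with
  | zero =>
    have h := (Gamma_diff (1 / 2) (by norm_num)).hasDerivAt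
    have hp := Real.Gamma_pos_of_pos (show (0:ℝ) < 1 / 2 by norm_num)
    rw [Nat.cast_zero, zero_add, Finset.range_zero, Finset.sum_empty, mul_zero, add_zero,
      mul_div_cancel₀ _ hp.ne']
    exact h
  | succ n ih =>
    have hn : (0:ℝ) < n + 1 / 2 := by positivity
    have h1 : HasDerivAt (fun s : ℝ => (s - 1) * Real.Gamma (s - 1)) _ (((n + 1 : ℕ) : ℝ) + 1 / 2) :=
      ((hasDerivAt_id _).sub_const 1).mul
        (HasDerivAt.comp_sub_const (((n + 1 : ℕ) : ℝ) + 1 / 2) 1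
          (by rw [show ((n + 1 : ℕ) : ℝ) + 1 / 2 - 1 = n + 1 / 2 by push_cast; ring]; exact ih))
    have h2 := h1.congr_of_eventuallyEq (f₁ := Real.Gamma) (by
      filter_upwards [lt_mem_nhds (show (1:ℝ) < ((n + 1 : ℕ) : ℝ) + 1 / 2 by push_cast; linarith)]
        with s hs
      rw [← Real.Gamma_add_one (by linarith : s - 1 ≠ 0)]
      ring_nf)
    refine h2.congr_deriv ?_
    have e : ((n + 1 : ℕ) : ℝ) + 1 / 2 = (n + 1 / 2) + 1 := by push_cast; ring
    rw [e, Real.Gamma_add_one hn.ne', Finset.sum_range_succ, add_sub_cancel_right]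
    field_simp
    ring

lemma FKT_deriv (ε : ℝ) (t : ℕ) :
    HasDerivAt (FKT ε t) (FKT ε t t * ∑ k ∈ Finset.range t, 1 / (2 * (k : ℝ) + 1)) t := by
  have hA : HasDerivAt (fun x : ℝ => Real.Gamma (((t : ℝ) + 1) / 2 + x / 2)) _ (t : ℝ) :=
    HasDerivAt.comp (h₂ := Real.Gamma) (t : ℝ)
      (by
        show HasDerivAt _ _ (((t : ℝ) + 1) / 2 + t / 2)
        rw [show ((t : ℝ) + 1) / 2 + t / 2 = t + 1 / 2 by ring]; exact Gamma_half_deriv t)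
      (((hasDerivAt_id (t : ℝ)).div_const 2).const_add (((t : ℝ) + 1) / 2))
  have hB : HasDerivAt (fun x : ℝ => Real.Gamma (((t : ℝ) + 1) / 2 - x / 2)) _ (t : ℝ) :=
    HasDerivAt.comp (h₂ := Real.Gamma) (t : ℝ)
      (by
        show HasDerivAt _ _ (((t : ℝ) + 1) / 2 - t / 2)
        rw [show ((t : ℝ) + 1) / 2 - t / 2 = 1 / 2 by ring]
        exact (Gamma_diff (1 / 2) (by norm_num)).hasDerivAt)
      (((hasDerivAt_id (t : ℝ)).div_const 2).const_sub (((t : ℝ) + 1) / 2))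
  have h := ((hA.const_mul (ε * 2 ^ t)).mul hB).div_const (Real.pi * (Nat.factorial t : ℝ))
  have hp := Real.Gamma_pos_of_pos (show (0:ℝ) < 1 / 2 by norm_num)
  have h' : HasDerivAt (FKT ε t) _ (t : ℝ) := h
  refine h'.congr_deriv ?_
  unfold FKT
  have e1 : ((t : ℝ) + 1) / 2 + t / 2 = t + 1 / 2 := by ring
  have e2 : ((t : ℝ) + 1) / 2 - t / 2 = 1 / 2 := by ring
  simp only [e1, e2]
  field_simp
  ring

lemma FKT_top (ε : ℝ) (hε : 0 < ε) (t : ℕ) : FKT ε t t ≤ ε * 2 ^ t / Real.sqrt (t + 1) := by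
  have key : ∀ n : ℕ, Real.Gamma (n + 1 / 2) * Real.Gamma (1 / 2) / (Real.pi * (Nat.factorial n : ℝ))
      ≤ 1 / Real.sqrt (n + 1) := by
    intro n
    induction n with
    | zero =>
      simp only [Nat.cast_zero, zero_add, Real.Gamma_one_half_eq, Nat.factorial_zero, Nat.cast_one]
      rw [Real.mul_self_sqrt Real.pi_pos.le]
      simp [Real.pi_pos.ne']
    | succ n ih =>
      have hn : (0:ℝ) < n + 1 / 2 := by positivity
      have hpi := Real.pi_pos
      have hn0 : (0:ℝ) ≤ n := n.cast_nonneg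
      have e : ((n + 1 : ℕ) : ℝ) + 1 / 2 = (n + 1 / 2) + 1 := by push_cast; ring
      have hf : (0:ℝ) < (Nat.factorial n : ℝ) := by positivity
      rw [e, Real.Gamma_add_one hn.ne', Nat.factorial_succ]
      push_cast
      have e2 : ((n:ℝ) + 1 / 2) * Real.Gamma (n + 1 / 2) * Real.Gamma (1 / 2) /
          (Real.pi * (((n:ℝ) + 1) * (Nat.factorial n : ℝ))) = ((n + 1 / 2) / (n + 1)) *
          (Real.Gamma (n + 1 / 2) * Real.Gamma (1 / 2) / (Real.pi * (Nat.factorial n : ℝ))) := by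
        field_simp
      rw [e2]
      refine (mul_le_mul_of_nonneg_left ih (by positivity)).trans ?_
      rw [div_mul_div_comm, mul_one, div_le_div_iff₀ (by positivity) (by positivity), one_mul]
      refine (sq_le_sq₀ (by positivity) (by positivity)).1 ?_
      · rw [mul_pow, mul_pow, Real.sq_sqrt (by positivity), Real.sq_sqrt (by positivity)]
        nlinarith [mul_nonneg hn0 hn0]
  have e : FKT ε t t = ε * 2 ^ t * (Real.Gamma (t + 1 / 2) * Real.Gamma (1 / 2) /
      (Real.pi * (Nat.factorial t : ℝ))) := by
    unfold FKT
    have e1 : ((t : ℝ) + 1) / 2 + t / 2 = t + 1 / 2 := by ring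
    have e2 : ((t : ℝ) + 1) / 2 - t / 2 = 1 / 2 := by ring
    rw [e1, e2]; ring
  rw [e, div_eq_mul_one_div (ε * 2 ^ t)]
  exact mul_le_mul_of_nonneg_left (key t) (by positivity)

lemma sum_le (t : ℕ) : ∑ k ∈ Finset.range t, 1 / (2 * (k : ℝ) + 1) ≤ 2 * Real.log (t + 1) := by
  induction t with
  | zero => simp
  | succ n ih =>
    rw [Finset.sum_range_succ]
    have hn0 : (0:ℝ) ≤ n := n.cast_nonneg
    have h := Real.one_sub_inv_le_log_of_pos (show (0:ℝ) < ((n:ℝ) + 2) / (n + 1) by positivity)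
    rw [Real.log_div (by positivity) (by positivity)] at h
    have h2 : 1 / (2 * (n : ℝ) + 1) ≤ 2 * (1 - (((n:ℝ) + 2) / (n + 1))⁻¹) := by
      have : 2 * (1 - (((n:ℝ) + 2) / (n + 1))⁻¹) = 2 / (n + 2) := by field_simp; ring
      rw [this, div_le_div_iff₀ (by positivity) (by positivity)]
      linarith
    have e : (((n + 1 : ℕ) : ℝ) + 1) = n + 2 := by push_cast; ring
    rw [e]
    linarith

lemma FKT_lip (ε : ℝ) (hε : 0 < ε) (t : ℕ) (x y : ℝ) (hy : 0 ≤ y) (hyx : y ≤ x) (hx : x ≤ t) :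
    FKT ε t x - FKT ε t y ≤
      (FKT ε t t * ∑ k ∈ Finset.range t, 1 / (2 * (k : ℝ) + 1)) * (x - y) := by
  set D := (FKT ε t t * ∑ k ∈ Finset.range t, 1 / (2 * (k : ℝ) + 1))
  rcases eq_or_lt_of_le hyx with h | h
  · simp [h]
  have hc := FKT_convex ε hε t
  have m1 : x ∈ Set.Ioo (-(t + 1 : ℝ)) (t + 1) := ⟨by linarith, by linarith⟩
  have m2 : y ∈ Set.Ioo (-(t + 1 : ℝ)) (t + 1) := ⟨by linarith, by linarith⟩
  have m3 : (t : ℝ) ∈ Set.Ioo (-(t + 1 : ℝ)) (t + 1) := ⟨by linarith, by linarith⟩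
  have h1 : slope (FKT ε t) y t ≤ D :=
    hc.slope_le_of_hasDerivAt m2 m3 (by linarith) (FKT_deriv ε t)
  have h2 : slope (FKT ε t) y x ≤ slope (FKT ε t) y t :=
    hc.slope_mono m2 ⟨m1, by simpa using h.ne'⟩ ⟨m3, by simpa using (h.trans_le hx).ne'⟩ hx
  have h3 := h2.trans h1
  rw [slope_def_field, div_le_iff₀ (by linarith)] at h3
  exact h3

/-- KT prediction Lipschitz envelope: the clipped KT prediction map
B_t(G) = Bet_{t+1}(clip_t(G)) is Lipschitz with constant C·2^t·log(t+2)/√(t+1),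
where C = (ε+1)(1 + 2/log 2) + 1. -/
theorem kt_prediction_lipschitz_envelope
    {H : Type*} [NormedAddCommGroup H] [InnerProductSpace ℝ H]
    (ε : ℝ) (hε : 0 < ε) (t : ℕ) (ht : 1 ≤ t) (a b : H) :
    ‖BetKT ε t (clipR (t : ℝ) a) - BetKT ε t (clipR (t : ℝ) b)‖ ≤
      ((ε + 1) * (1 + 2 / Real.log 2) + 1) *
        (2 ^ t * Real.log ((t : ℝ) + 2) / Real.sqrt ((t : ℝ) + 1)) * ‖a - b‖ := by
  have ht0 : (0:ℝ) ≤ t := t.cast_nonneg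
  have ht1 : (1:ℝ) ≤ t := by exact_mod_cast ht
  have hab := clip_lip (t:ℝ) ht0 a b
  have hp := clip_norm_le (t:ℝ) ht0 a
  have hq := clip_norm_le (t:ℝ) ht0 b
  rw [bet_eq ε hε t _ hp, bet_eq ε hε t _ hq]
  set p := clipR (t:ℝ) a
  set q := clipR (t:ℝ) b
  set S := ∑ k ∈ Finset.range t, 1 / (2 * (k : ℝ) + 1) with hS
  have hS0 : 0 ≤ S := Finset.sum_nonneg (fun k _ => by positivity)
  have hF0 : 0 < FKT ε t t := FKT_pos ε hε t t ⟨by linarith, by linarith⟩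
  have hdiff : |FKT ε t ‖p‖ - FKT ε t ‖q‖| ≤ FKT ε t t * S * ‖p - q‖ := by
    have hnn := abs_norm_sub_norm_le p q
    rcases le_total ‖q‖ ‖p‖ with h | h
    · rw [abs_of_nonneg (sub_nonneg.2 (FKT_mono ε hε t _ _ (norm_nonneg _) h hp))]
      refine (FKT_lip ε hε t _ _ (norm_nonneg _) h hp).trans ?_
      exact mul_le_mul_of_nonneg_left ((le_abs_self _).trans hnn) (by positivity)
    · rw [abs_sub_comm, abs_of_nonneg (sub_nonneg.2 (FKT_mono ε hε t _ _ (norm_nonneg _) h hq))]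
      refine (FKT_lip ε hε t _ _ (norm_nonneg _) h hq).trans ?_
      rw [abs_sub_comm] at hnn
      exact mul_le_mul_of_nonneg_left ((le_abs_self _).trans hnn) (by positivity)
  have hFp : FKT ε t ‖p‖ ≤ FKT ε t t := FKT_mono ε hε t _ _ (norm_nonneg _) hp le_rfl
  have hFp0 : 0 < FKT ε t ‖p‖ :=
    FKT_pos ε hε t _ ⟨by linarith [norm_nonneg p], by linarith⟩
  have e : (FKT ε t ‖p‖ / (t + 1)) • p - (FKT ε t ‖q‖ / (t + 1)) • q =
      (FKT ε t ‖p‖ / (t + 1)) • (p - q) + ((FKT ε t ‖p‖ - FKT ε t ‖q‖) / (t + 1)) • q := by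
    rw [sub_div, sub_smul, smul_sub]; abel
  have h1 : ‖(FKT ε t ‖p‖ / (t + 1)) • p - (FKT ε t ‖q‖ / (t + 1)) • q‖ ≤
      FKT ε t t * (1 / (t + 1) + S) * ‖p - q‖ := by
    rw [e]
    refine (norm_add_le _ _).trans ?_
    rw [norm_smul, norm_smul, Real.norm_of_nonneg (by positivity), Real.norm_eq_abs, abs_div,
      abs_of_pos (show (0:ℝ) < t + 1 by positivity)]
    have b1 : FKT ε t ‖p‖ / (t + 1) * ‖p - q‖ ≤ FKT ε t t / (t + 1) * ‖p - q‖ := by gcongr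
    have b2 : |FKT ε t ‖p‖ - FKT ε t ‖q‖| / (t + 1) * ‖q‖ ≤
        (FKT ε t t * S * ‖p - q‖) / (t + 1) * (t + 1) := by
      gcongr
      linarith
    rw [div_mul_cancel₀ _ (by positivity)] at b2
    calc _ ≤ _ := add_le_add b1 b2
      _ = _ := by ring
  have hl2 : 0 < Real.log 2 := Real.log_pos (by norm_num)
  have hl21 : Real.log 2 ≤ 1 := by linarith [Real.log_two_lt_d9]
  have hl2' : 1 / 2 ≤ Real.log 2 := by linarith [Real.log_two_gt_d9]
  have hlt : Real.log 2 ≤ Real.log (t + 2) := Real.log_le_log (by norm_num) (by linarith)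
  have hlt2 : Real.log (t + 1) ≤ Real.log (t + 2) := Real.log_le_log (by linarith) (by linarith)
  have h2 : 1 / ((t:ℝ) + 1) + S ≤ 3 * Real.log (t + 2) := by
    have := sum_le t
    have h3 : 1 / ((t:ℝ) + 1) ≤ 1 / 2 := by
      apply one_div_le_one_div_of_le <;> linarith
    linarith
  have h3 : (3:ℝ) ≤ 1 + 2 / Real.log 2 := by
    have : 2 ≤ 2 / Real.log 2 := by rw [le_div_iff₀ hl2]; linarith
    linarith
  have h4 : ε * 3 ≤ (ε + 1) * (1 + 2 / Real.log 2) + 1 := by nlinarith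
  refine h1.trans ?_
  have hL : 0 < Real.log ((t:ℝ) + 2) := by linarith
  have hsq : 0 < Real.sqrt ((t:ℝ) + 1) := Real.sqrt_pos.2 (by linarith)
  calc FKT ε t t * (1 / (t + 1) + S) * ‖p - q‖
      ≤ (ε * 2 ^ t / Real.sqrt (t + 1)) * (3 * Real.log (t + 2)) * ‖a - b‖ := by
        gcongr
        exact FKT_top ε hε t
    _ = (ε * 3) * (2 ^ t * Real.log ((t : ℝ) + 2) / Real.sqrt ((t : ℝ) + 1)) * ‖a - b‖ := by ring
    _ ≤ _ := by gcongr
end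

section
/- Let ε > 0, let t ≥ 1 be an integer, and let H be a real Hilbert space. Define h_{t+1}^{SE}(x) = tanh(x/(t+2)) · (ε/√(t+1)) · exp(x²/(2(t+1))), define Bet_{t+1}(G) = (h_{t+1}^{SE}(‖G‖)/‖G‖)·G for G ≠ 0 and Bet_{t+1}(0) = 0, clip_t(G) = G if ‖G‖ ≤ t and (t/‖G‖)·G otherwise, and B_t(G) = Bet_{t+1}(clip_t(G)). Then for all a, b ∈ H, ‖B_t(a) − B_t(b)‖ ≤ (2ε+1) · (exp(t/2)/√(t+1)) · ‖a − b‖. -/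
open Classical

/-- Shifted-exponential coin-betting function
h_{t+1}^{SE}(x) = tanh(x/(t+2))·(ε/√(t+1))·exp(x²/(2(t+1))). -/
noncomputable def hSE (ε : ℝ) (t : ℕ) (x : ℝ) : ℝ :=
  Real.tanh (x / ((t : ℝ) + 2)) * (ε / Real.sqrt ((t : ℝ) + 1)) *
    Real.exp (x ^ 2 / (2 * ((t : ℝ) + 1)))

/-- Radial betting map Bet_{t+1}(G) = (h_{t+1}^{SE}(‖G‖)/‖G‖)·G, Bet_{t+1}(0) = 0. -/
noncomputable def BetSE {H : Type*} [NormedAddCommGroup H] [InnerProductSpace ℝ H]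
    (ε : ℝ) (t : ℕ) (G : H) : H :=
  if G = 0 then 0 else (hSE ε t ‖G‖ / ‖G‖) • G

theorem aux_tanh_deriv (x : ℝ) : HasDerivAt Real.tanh (1 / Real.cosh x ^ 2) x := by
  have h : Real.tanh = fun y => Real.sinh y / Real.cosh y := by
    funext y
    exact Real.tanh_eq_sinh_div_cosh y
  rw [h]
  have h2 := (Real.hasDerivAt_sinh x).div (Real.hasDerivAt_cosh x) (Real.cosh_pos x).ne'
  refine HasDerivAt.congr_deriv h2 ?_
  rw [← Real.cosh_sq_sub_sinh_sq x]
  ring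

theorem aux_tanh_nonneg (x : ℝ) (hx : 0 ≤ x) : 0 ≤ Real.tanh x := by
  rw [Real.tanh_eq_sinh_div_cosh]
  exact div_nonneg (Real.sinh_nonneg_iff.2 hx) (Real.cosh_pos x).le

theorem aux_radial {H : Type*} [NormedAddCommGroup H] [InnerProductSpace ℝ H]
    (g : ℝ → ℝ) (L : ℝ) (hL : 0 ≤ L) (h0 : g 0 = 0) (hg : ∀ x, 0 ≤ x → 0 ≤ g x)
    (hlip : ∀ x y, 0 ≤ x → 0 ≤ y → |g x - g y| ≤ L * |x - y|) (a b : H) :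
    ‖(g ‖a‖ / ‖a‖) • a - (g ‖b‖ / ‖b‖) • b‖ ≤ L * ‖a - b‖ := by
  have key : ∀ c : H, ∃ p, p = g ‖c‖ / ‖c‖ ∧ 0 ≤ p ∧ p ≤ L ∧ p * ‖c‖ = g ‖c‖ := by
    intro c
    refine ⟨_, rfl, div_nonneg (hg _ (norm_nonneg c)) (norm_nonneg c), ?_, ?_⟩
    · apply div_le_of_le_mul₀ (norm_nonneg c) hL
      have := hlip ‖c‖ 0 (norm_nonneg c) le_rfl
      rw [h0, sub_zero, sub_zero, abs_of_nonneg (norm_nonneg c)] at this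
      exact (le_abs_self _).trans this
    · by_cases hc : ‖c‖ = 0
      · rw [hc, h0]; simp
      · field_simp
  obtain ⟨p, hp, hp0, hpL, hpg⟩ := key a
  obtain ⟨q, hq, hq0, hqL, hqg⟩ := key b
  rw [← hp, ← hq]
  apply le_of_sq_le_sq _ (by positivity)
  rw [mul_pow, norm_sub_sq_real, norm_sub_sq_real, norm_smul, norm_smul, inner_smul_left,
    inner_smul_right, Real.norm_of_nonneg hp0, Real.norm_of_nonneg hq0]
  have hI := real_inner_le_norm a b
  have hl := hlip ‖a‖ ‖b‖ (norm_nonneg a) (norm_nonneg b)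
  rw [← hpg, ← hqg] at hl
  have hl2 := pow_le_pow_left₀ (abs_nonneg _) hl 2
  rw [mul_pow, sq_abs, sq_abs] at hl2
  have hpq : p * q ≤ L * L := mul_le_mul hpL hqL hq0 hL
  have := mul_le_mul_of_nonneg_right hpq (sub_nonneg.2 hI)
  simp only [conj_trivial]
  nlinarith

theorem aux_h_deriv (ε : ℝ) (t : ℕ) (x : ℝ) :
    HasDerivAt (hSE ε t)
      (ε / Real.sqrt ((t : ℝ) + 1) * Real.exp (x ^ 2 / (2 * ((t : ℝ) + 1))) *
        (1 / Real.cosh (x / ((t : ℝ) + 2)) ^ 2 / ((t : ℝ) + 2)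
          + Real.tanh (x / ((t : ℝ) + 2)) * (x / ((t : ℝ) + 1)))) x := by
  have h1 : HasDerivAt (fun y : ℝ => Real.tanh (y / ((t : ℝ) + 2)))
      (1 / Real.cosh (x / ((t : ℝ) + 2)) ^ 2 * (1 / ((t : ℝ) + 2))) x :=
    HasDerivAt.comp (h₂ := Real.tanh) (h := fun y : ℝ => y / ((t : ℝ) + 2)) x
      (aux_tanh_deriv (x / ((t : ℝ) + 2))) ((hasDerivAt_id x).div_const ((t : ℝ) + 2))
  have h2 : HasDerivAt (fun y : ℝ => Real.exp (y ^ 2 / (2 * ((t : ℝ) + 1)))) _ x :=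
    (((hasDerivAt_id x).pow 2).div_const (2 * ((t : ℝ) + 1))).exp
  have h3 := (h1.mul_const (ε / Real.sqrt ((t : ℝ) + 1))).mul h2
  refine HasDerivAt.congr_deriv (f := hSE ε t) h3 ?_
  have : (t : ℝ) + 1 ≠ 0 := by positivity
  simp only [id, Pi.pow_apply]
  field_simp
  push_cast
  ring

theorem aux_h_deriv_bound (ε : ℝ) (hε : 0 < ε) (t : ℕ) (x : ℝ) (hx0 : 0 ≤ x) (hxt : x ≤ t) :
    ‖ε / Real.sqrt ((t : ℝ) + 1) * Real.exp (x ^ 2 / (2 * ((t : ℝ) + 1))) *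
        (1 / Real.cosh (x / ((t : ℝ) + 2)) ^ 2 / ((t : ℝ) + 2)
          + Real.tanh (x / ((t : ℝ) + 2)) * (x / ((t : ℝ) + 1)))‖
      ≤ ε * (Real.exp ((t : ℝ) / 2) / Real.sqrt ((t : ℝ) + 1)) := by
  have ht0 : (0 : ℝ) ≤ t := Nat.cast_nonneg t
  have hth := aux_tanh_nonneg (x / ((t : ℝ) + 2)) (by positivity)
  have hth1 := (Real.tanh_lt_one (x / ((t : ℝ) + 2))).le
  have hc := Real.one_le_cosh (x / ((t : ℝ) + 2))
  rw [Real.norm_of_nonneg (by positivity)]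
  have e1 : Real.exp (x ^ 2 / (2 * ((t : ℝ) + 1))) ≤ Real.exp ((t : ℝ) / 2) := by
    apply Real.exp_le_exp.2
    rw [div_le_div_iff₀ (by positivity) (by positivity)]
    nlinarith
  have e2 : 1 / Real.cosh (x / ((t : ℝ) + 2)) ^ 2 ≤ 1 := by
    rw [div_le_one (by positivity)]
    exact one_le_pow₀ hc
  have e3 : x / ((t : ℝ) + 1) ≤ t / ((t : ℝ) + 1) := by gcongr
  have e4 : 1 / Real.cosh (x / ((t : ℝ) + 2)) ^ 2 / ((t : ℝ) + 2)
      + Real.tanh (x / ((t : ℝ) + 2)) * (x / ((t : ℝ) + 1)) ≤ 1 := by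
    calc _ ≤ 1 / ((t : ℝ) + 2) + 1 * (t / ((t : ℝ) + 1)) := by gcongr
      _ ≤ 1 := by
        rw [one_mul, div_add_div _ _ (by positivity) (by positivity), div_le_one (by positivity)]
        nlinarith
  calc _ ≤ ε / Real.sqrt ((t : ℝ) + 1) * Real.exp ((t : ℝ) / 2) * 1 := by gcongr
    _ = _ := by ring

theorem aux_bet_clip {H : Type*} [NormedAddCommGroup H] [InnerProductSpace ℝ H]
    (ε : ℝ) (t : ℕ) (ht : 1 ≤ t) (a : H) :
    BetSE ε t (clipR (t : ℝ) a) = (hSE ε t (min ‖a‖ t) / ‖a‖) • a := by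
  have ht0 : (0 : ℝ) < t := by exact_mod_cast ht
  unfold clipR
  split_ifs with h
  · rw [min_eq_left h]
    unfold BetSE
    split_ifs with h2
    · simp [h2]
    · rfl
  · push Not at h
    have ha : 0 < ‖a‖ := ht0.trans h
    have hn : ‖((t : ℝ) / ‖a‖) • a‖ = t := by
      rw [norm_smul, Real.norm_of_nonneg (by positivity)]
      field_simp
    have hne : ((t : ℝ) / ‖a‖) • a ≠ 0 := by
      rw [← norm_pos_iff, hn]
      exact ht0
    unfold BetSE
    rw [if_neg hne, hn, min_eq_right h.le, smul_smul]
    congr 1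
    field_simp

/-- Shifted-exponential prediction Lipschitz envelope: the clipped SE prediction map
B_t(G) = Bet_{t+1}(clip_t(G)) is Lipschitz with constant (2ε+1)·exp(t/2)/√(t+1). -/
theorem se_prediction_lipschitz_envelope
    {H : Type*} [NormedAddCommGroup H] [InnerProductSpace ℝ H]
    (ε : ℝ) (hε : 0 < ε) (t : ℕ) (ht : 1 ≤ t) (a b : H) :
    ‖BetSE ε t (clipR (t : ℝ) a) - BetSE ε t (clipR (t : ℝ) b)‖ ≤
      (2 * ε + 1) * (Real.exp ((t : ℝ) / 2) / Real.sqrt ((t : ℝ) + 1)) * ‖a - b‖ := by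
  have ht0 : (0 : ℝ) ≤ t := Nat.cast_nonneg t
  rw [aux_bet_clip ε t ht, aux_bet_clip ε t ht]
  have hC : 0 ≤ Real.exp ((t : ℝ) / 2) / Real.sqrt ((t : ℝ) + 1) := by positivity
  have main := aux_radial (fun r => hSE ε t (min r t))
    (ε * (Real.exp ((t : ℝ) / 2) / Real.sqrt ((t : ℝ) + 1))) (by positivity)
    (by simp [hSE])
    (by
      intro x hx
      have := aux_tanh_nonneg (min x t / ((t : ℝ) + 2)) (by positivity)
      simp only [hSE]
      positivity)
    (by
      intro x y hx hy
      have h := (convex_Icc (0 : ℝ) t).norm_image_sub_le_of_norm_hasDerivWithin_le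
        (fun z _ => (aux_h_deriv ε t z).hasDerivWithinAt)
        (fun z hz => aux_h_deriv_bound ε hε t z hz.1 hz.2)
        (x := min y t) (y := min x t)
        ⟨le_min hy ht0, min_le_right _ _⟩ ⟨le_min hx ht0, min_le_right _ _⟩
      rw [Real.norm_eq_abs, Real.norm_eq_abs] at h
      refine h.trans ?_
      refine mul_le_mul_of_nonneg_left ?_ (by positivity)
      have := abs_min_sub_min_le_max x (t : ℝ) y t
      simpa using this) a b
  refine main.trans ?_
  gcongr
  linarith
end

section
/- Let 0 < η < 1 and ε > 0 be real, let c be a real number with c ≥ −2·log 2/log η, define q(t) = ⌈c·t⌉ for integers t ≥ 0 and Q(s,t) = Σ_{r=s}^{t−1} q(r), let N ≥ 1 be an integer, and set C = (ε+1)·(1 + 2/log 2) + 1. Then for every integer T ≥ 1, 2·√N · Σ_{t=1}^{T} (C · 2^t · log(t+2)/√(t+1)) · Σ_{s=0}^{t−1} η^{Q(s,t)} ≤ 48·C·√N·√T. -/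
lemma kt_S_bound (w : ℕ → ℝ) (h0 : ∀ r, 0 ≤ w r) (h1 : ∀ r, w r ≤ (1/4)^r) (n : ℕ) :
    ∑ s ∈ Finset.range (n+1), ∏ r ∈ Finset.Ico s (n+1), w r ≤ 2 * (1/4)^n := by
  have hrec : ∀ m : ℕ, ∑ s ∈ Finset.range (m+1), ∏ r ∈ Finset.Ico s (m+1), w r
      = (∑ s ∈ Finset.range m, ∏ r ∈ Finset.Ico s m, w r + 1) * w m := by
    intro m
    rw [Finset.sum_range_succ, add_mul, Finset.sum_mul]
    congr 1
    · refine Finset.sum_congr rfl fun s hs => ?_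
      rw [Finset.prod_Ico_succ_top (Finset.mem_range.mp hs).le]
    · simp
  have hle : ∀ m : ℕ, ∑ s ∈ Finset.range m, ∏ r ∈ Finset.Ico s m, w r ≤ 1 := by
    intro m
    induction m with
    | zero => simp
    | succ k ih =>
      rw [hrec]
      rcases Nat.eq_zero_or_pos k with rfl | hk
      · have := h1 0
        simpa using this
      · have h2 : ((1:ℝ)/4)^k ≤ (1/4)^1 := pow_le_pow_of_le_one (by norm_num) (by norm_num) hk
        have := h1 k
        have := h0 k
        nlinarith
  rw [hrec]
  have := hle n
  exact mul_le_mul (by linarith) (h1 n) (h0 n) (by norm_num)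

lemma kt_log_bound (t : ℕ) :
    Real.log ((t : ℝ) + 2) / Real.sqrt ((t : ℝ) + 1) ≤ 2 := by
  have ht : (0:ℝ) ≤ t := Nat.cast_nonneg t
  have hs : 0 < Real.sqrt ((t : ℝ) + 1) := Real.sqrt_pos.mpr (by linarith)
  rw [div_le_iff₀ hs]
  have h1 : Real.log (Real.sqrt ((t:ℝ)+2)) ≤ Real.sqrt ((t:ℝ)+2) - 1 :=
    Real.log_le_sub_one_of_pos (Real.sqrt_pos.mpr (by linarith))
  rw [Real.log_sqrt (by linarith)] at h1
  have h2 : Real.sqrt ((t:ℝ)+2) ≤ Real.sqrt ((t:ℝ)+1) + 1 := by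
    rw [Real.sqrt_le_left (by linarith)]
    nlinarith [Real.sq_sqrt (show (0:ℝ) ≤ (t:ℝ)+1 by linarith)]
  linarith

lemma kt_geom (T : ℕ) : ∑ t ∈ Finset.Icc 1 T, 16 * ((1:ℝ)/2)^t = 16 * (1 - (1/2)^T) := by
  induction T with
  | zero => simp
  | succ k ih =>
    rw [Finset.sum_Icc_succ_top (by omega), ih]
    ring



/-- Linear KT gossip schedule bound: with 0 < η < 1, ε > 0, c ≥ −2·log 2/log η,
q(t) = ⌈c·t⌉, Q(s,t) = Σ_{r=s}^{t−1} q(r), and C = (ε+1)(1 + 2/log 2) + 1,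
2√N·Σ_{t=1}^T (C·2^t·log(t+2)/√(t+1))·Σ_{s<t} η^{Q(s,t)} ≤ 48·C·√N·√T. -/
theorem kt_linear_gossip_schedule (η : ℝ) (hη0 : 0 < η) (hη1 : η < 1)
    (ε : ℝ) (hε : 0 < ε) (c : ℝ) (hc : -(2 * Real.log 2) / Real.log η ≤ c)
    (N : ℕ) (hN : 1 ≤ N) (T : ℕ) (hT : 1 ≤ T) :
    2 * Real.sqrt N *
        ∑ t ∈ Finset.Icc 1 T,
          (((ε + 1) * (1 + 2 / Real.log 2) + 1) *
              (2 ^ t * Real.log ((t : ℝ) + 2) / Real.sqrt ((t : ℝ) + 1))) *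
            ∑ s ∈ Finset.range t,
              η ^ (∑ r ∈ Finset.Ico s t, (⌈c * (r : ℝ)⌉).toNat)
      ≤ 48 * ((ε + 1) * (1 + 2 / Real.log 2) + 1) * Real.sqrt N * Real.sqrt T := by
  have hlog : Real.log η < 0 := Real.log_neg hη0 hη1
  have hl2 : 0 < Real.log 2 := Real.log_pos (by norm_num)
  have hc2 : c * Real.log η ≤ -(2 * Real.log 2) := by
    rwa [div_le_iff_of_neg hlog] at hc
  have hw : ∀ r : ℕ, η ^ (⌈c * (r : ℝ)⌉).toNat ≤ (1/4 : ℝ)^r := by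
    intro r
    have h1 : c * (r:ℝ) ≤ ((⌈c * (r : ℝ)⌉).toNat : ℝ) := by
      refine (Int.le_ceil _).trans ?_
      exact_mod_cast Int.self_le_toNat _
    rw [← Real.log_le_log_iff (by positivity) (by positivity), Real.log_pow, Real.log_pow]
    have h4 : Real.log (1/4) = -(2 * Real.log 2) := by
      rw [show (1/4:ℝ) = (2^2)⁻¹ by norm_num, Real.log_inv, Real.log_pow]
      norm_num
    rw [h4]
    have hr : (0:ℝ) ≤ r := Nat.cast_nonneg r
    nlinarith [mul_le_mul_of_nonpos_right h1 hlog.le, mul_le_mul_of_nonneg_left hc2 hr]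
  set C := (ε + 1) * (1 + 2 / Real.log 2) + 1 with hC
  have hCpos : 0 < C := by positivity
  have hterm : ∀ t ∈ Finset.Icc 1 T,
      (C * (2 ^ t * Real.log ((t : ℝ) + 2) / Real.sqrt ((t : ℝ) + 1))) *
            ∑ s ∈ Finset.range t,
              η ^ (∑ r ∈ Finset.Ico s t, (⌈c * (r : ℝ)⌉).toNat) ≤ C * (16 * ((1:ℝ)/2)^t) := by
    intro t ht
    obtain ⟨n, rfl⟩ : ∃ n, t = n + 1 := ⟨t - 1, by have := (Finset.mem_Icc.mp ht).1; omega⟩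
    have hS := kt_S_bound (fun r => η ^ (⌈c * (r : ℝ)⌉).toNat) (fun r => by positivity) hw n
    simp only [Finset.prod_pow_eq_pow_sum] at hS
    have hL := kt_log_bound (n+1)
    rw [mul_assoc, mul_div_assoc]
    refine mul_le_mul_of_nonneg_left ?_ hCpos.le
    calc _ ≤ (2^(n+1) * 2) * (2 * (1/4 : ℝ)^n) := by
          refine mul_le_mul (mul_le_mul_of_nonneg_left hL (by positivity)) hS ?_ (by positivity)
          exact Finset.sum_nonneg fun s _ => by positivity
      _ = 16 * (1/2:ℝ)^(n+1) := by
          rw [show (1/4:ℝ) = (1/2) * (1/2) by norm_num, mul_pow, pow_succ, pow_succ]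
          have : (2:ℝ)^n * (1/2)^n = 1 := by rw [← mul_pow]; norm_num
          linear_combination 8 * (1/2:ℝ)^n * this
  have hsum := Finset.sum_le_sum hterm
  rw [← Finset.mul_sum, kt_geom] at hsum
  have hT1 : 1 ≤ Real.sqrt T := Real.one_le_sqrt.mpr (by exact_mod_cast hT)
  have hp : (0:ℝ) < (1/2)^T := by positivity
  have h2 : C * (16 * (1 - (1/2:ℝ)^T)) ≤ C * (24 * Real.sqrt T) :=
    mul_le_mul_of_nonneg_left (by linarith) hCpos.le
  calc _ ≤ 2 * Real.sqrt N * (C * (24 * Real.sqrt T)) :=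
        mul_le_mul_of_nonneg_left (hsum.trans h2) (by positivity)
    _ = _ := by ring
end

section
/- Let 0 < η < 1 and ε > 0 be real, let c be a real number with c ≥ −3/(2·log η), define q(t) = ⌈c·t⌉ for integers t ≥ 0 and Q(s,t) = Σ_{r=s}^{t−1} q(r), and let N ≥ 1 be an integer. Then for every integer T ≥ 1, 2·√N · Σ_{t=1}^{T} ((2ε+1) · exp(t/2)/√(t+1)) · Σ_{s=0}^{t−1} η^{Q(s,t)} ≤ 4·e^{3/2}·(2ε+1)·√N·√T. -/
lemma aux_sqrt_sum (T : ℕ) :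
    ∑ t ∈ Finset.Icc 1 T, 1 / Real.sqrt ((t : ℝ) + 1) ≤ 2 * Real.sqrt T := by
  induction T with
  | zero => simp
  | succ n ih =>
    rw [Finset.sum_Icc_succ_top (by omega)]
    push_cast
    have h0 : (0 : ℝ) ≤ n := Nat.cast_nonneg n
    set a := Real.sqrt (n : ℝ) with ha
    set b := Real.sqrt ((n : ℝ) + 1) with hb
    have ha2 : a ^ 2 = n := Real.sq_sqrt h0
    have hb2 : b ^ 2 = n + 1 := Real.sq_sqrt (by linarith)
    have ha0 : 0 ≤ a := Real.sqrt_nonneg _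
    have hb0 : 0 < b := Real.sqrt_pos.mpr (by linarith)
    have h1 : 1 / Real.sqrt ((n : ℝ) + 1 + 1) ≤ 1 / b :=
      one_div_le_one_div_of_le hb0 (Real.sqrt_le_sqrt (by linarith))
    have h2 : 1 / b ≤ 2 * (b - a) := by
      rw [div_le_iff₀ hb0]
      nlinarith [sq_nonneg (b - a)]
    linarith

lemma aux_inner (η : ℝ) (hη0 : 0 < η) (hη1 : η < 1)
    (c : ℝ) (hc : -(3 : ℝ) / (2 * Real.log η) ≤ c) (t : ℕ) (ht : 1 ≤ t) :
    Real.exp ((t : ℝ) / 2) * ∑ s ∈ Finset.range t,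
      η ^ (∑ r ∈ Finset.Ico s t, (⌈c * (r : ℝ)⌉).toNat) ≤ Real.exp (3 / 2) := by
  have hlog : Real.log η < 0 := Real.log_neg hη0 hη1
  have hc' : c * Real.log η ≤ -(3 / 2) := by
    rw [div_le_iff_of_neg (by linarith)] at hc
    linarith
  have hterm : ∀ s ∈ Finset.range t,
      η ^ (∑ r ∈ Finset.Ico s t, (⌈c * (r : ℝ)⌉).toNat)
        ≤ Real.exp (-(3 / 2) * ((t : ℝ) - 1)) := by
    intro s hs
    have hs' := Finset.mem_range.mp hs
    have hQ : (⌈c * ((t - 1 : ℕ) : ℝ)⌉).toNat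
        ≤ ∑ r ∈ Finset.Ico s t, (⌈c * (r : ℝ)⌉).toNat :=
      Finset.single_le_sum (f := fun r : ℕ => (⌈c * (r : ℝ)⌉).toNat)
        (fun _ _ => Nat.zero_le _) (Finset.mem_Ico.mpr ⟨by omega, by omega⟩)
    refine (pow_le_pow_of_le_one hη0.le hη1.le hQ).trans ?_
    rw [Nat.cast_sub ht, Nat.cast_one]
    have ht1 : (1 : ℝ) ≤ t := by exact_mod_cast ht
    set m := (⌈c * ((t : ℝ) - 1)⌉).toNat with hm
    have hmc : c * ((t : ℝ) - 1) ≤ (m : ℝ) := by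
      refine (Int.le_ceil _).trans ?_
      rw [← Int.cast_natCast (R := ℝ) m]
      exact Int.cast_le.mpr (Int.self_le_toNat _)
    rw [← Real.exp_log (pow_pos hη0 m), Real.log_pow]
    apply Real.exp_le_exp.mpr
    nlinarith
  have hsum := Finset.sum_le_sum hterm
  rw [Finset.sum_const, Finset.card_range, nsmul_eq_mul] at hsum
  have hte : (t : ℝ) ≤ Real.exp t := by linarith [Real.add_one_le_exp (t : ℝ)]
  calc _ ≤ Real.exp ((t : ℝ) / 2) * (Real.exp t * Real.exp (-(3 / 2) * ((t : ℝ) - 1))) := by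
        refine mul_le_mul_of_nonneg_left (hsum.trans ?_) (Real.exp_pos _).le
        exact mul_le_mul_of_nonneg_right hte (Real.exp_pos _).le
    _ = Real.exp (3 / 2) := by
        rw [← Real.exp_add, ← Real.exp_add]
        congr 1
        ring

/-- Linear shifted-exponential gossip schedule bound: with 0 < η < 1, ε > 0,
c ≥ −3/(2·log η), q(t) = ⌈c·t⌉, and Q(s,t) = Σ_{r=s}^{t−1} q(r),
2√N·Σ_{t=1}^T ((2ε+1)·exp(t/2)/√(t+1))·Σ_{s<t} η^{Q(s,t)} ≤ 4·e^{3/2}·(2ε+1)·√N·√T. -/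
theorem se_linear_gossip_schedule (η : ℝ) (hη0 : 0 < η) (hη1 : η < 1)
    (ε : ℝ) (hε : 0 < ε) (c : ℝ) (hc : -(3 : ℝ) / (2 * Real.log η) ≤ c)
    (N : ℕ) (hN : 1 ≤ N) (T : ℕ) (hT : 1 ≤ T) :
    2 * Real.sqrt N *
        ∑ t ∈ Finset.Icc 1 T,
          ((2 * ε + 1) * (Real.exp ((t : ℝ) / 2) / Real.sqrt ((t : ℝ) + 1))) *
            ∑ s ∈ Finset.range t,
              η ^ (∑ r ∈ Finset.Ico s t, (⌈c * (r : ℝ)⌉).toNat)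
      ≤ 4 * Real.exp (3 / 2) * (2 * ε + 1) * Real.sqrt N * Real.sqrt T := by
  have key : ∑ t ∈ Finset.Icc 1 T,
          ((2 * ε + 1) * (Real.exp ((t : ℝ) / 2) / Real.sqrt ((t : ℝ) + 1))) *
            ∑ s ∈ Finset.range t,
              η ^ (∑ r ∈ Finset.Ico s t, (⌈c * (r : ℝ)⌉).toNat)
      ≤ (2 * ε + 1) * Real.exp (3 / 2) * (2 * Real.sqrt T) := by
    refine le_trans ?_ (mul_le_mul_of_nonneg_left (aux_sqrt_sum T) (by positivity))
    rw [Finset.mul_sum]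
    refine Finset.sum_le_sum fun t ht => ?_
    have h := aux_inner η hη0 hη1 c hc t (Finset.mem_Icc.mp ht).1
    have h2 := mul_le_mul_of_nonneg_left h
      (show 0 ≤ (2 * ε + 1) * (1 / Real.sqrt ((t : ℝ) + 1)) by positivity)
    calc _ = _ := by ring
      _ ≤ _ := h2
      _ = _ := by ring
  calc _ ≤ _ := mul_le_mul_of_nonneg_left key (show 0 ≤ 2 * Real.sqrt N by positivity)
    _ = _ := by ring
end

section
/- Let H be a real Hilbert space, ε > 0, and let F : ℕ → ℝ → ℝ be a family of functions satisfying: (a) F_0(0) = ε; (b) for every t, F_t is even and F_t(x) > 0 for all |x| ≤ t + 1, and log F_t is convex on [−(t+1), t+1]; (c) for every t ≥ 1, every real x with |x| ≤ t − 1, and every real c with |c| ≤ 1, (1 + c·β_t(x))·F_{t−1}(x) ≥ F_t(x + c), where β_t(x) = (F_t(x+1) − F_t(x−1))/(F_t(x+1) + F_t(x−1)); and (d) for every t ≥ 1, the map z ↦ F_t(√z) is convex on [0, t²]. Let T ≥ 1 be an integer, let c_0,…,c_{T−1} ∈ H satisfy ‖c_t‖ ≤ 1, set S_t = Σ_{s=0}^{t−1}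 c_s and y_t = Bet_{t+1}(S_t), where Bet_{t+1}(G) = (h_{t+1}(‖G‖)/‖G‖)·G for G ≠ 0 with h_{t+1}(x) = β_{t+1}(x)·F_t(x), and Bet_{t+1}(0) = 0. Then for every u ∈ H, Σ_{t=0}^{T−1} (⟨u, c_t⟩ − ⟨c_t, y_t⟩) ≤ sup_{0 ≤ s ≤ T} (‖u‖·s − F_T(s)) + ε. -/
open scoped RealInnerProductSpace
open Classical

/-- Radial Hilbert-space coin-betting regret: for an excellent coin-betting potential F with
endowment ε, coins c_t of norm at most one, states S_t = Σ_{s<t} c_s, and predictions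
y_t = Bet_{t+1}(S_t), the linearized regret against any comparator u is bounded by the
restricted terminal Fenchel conjugate of F_T at ‖u‖ plus ε. -/
theorem radial_hilbert_coin_betting_regret
    {H : Type*} [NormedAddCommGroup H] [InnerProductSpace ℝ H]
    (ε : ℝ) (hε : 0 < ε) (F : ℕ → ℝ → ℝ)
    (ha : F 0 0 = ε)
    (heven : ∀ t : ℕ, ∀ x : ℝ, F t (-x) = F t x)
    (hpos : ∀ t : ℕ, ∀ x : ℝ, |x| ≤ (t : ℝ) + 1 → 0 < F t x)
    (hlogconv : ∀ t : ℕ,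
      ConvexOn ℝ (Set.Icc (-((t : ℝ) + 1)) ((t : ℝ) + 1)) (fun x => Real.log (F t x)))
    (hc : ∀ t : ℕ, 1 ≤ t → ∀ x : ℝ, |x| ≤ (t : ℝ) - 1 → ∀ c : ℝ, |c| ≤ 1 →
      F t (x + c) ≤
        (1 + c * ((F t (x + 1) - F t (x - 1)) / (F t (x + 1) + F t (x - 1)))) * F (t - 1) x)
    (hd : ∀ t : ℕ, 1 ≤ t →
      ConvexOn ℝ (Set.Icc (0 : ℝ) ((t : ℝ) ^ 2)) (fun z => F t (Real.sqrt z)))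
    (T : ℕ) (hT : 1 ≤ T)
    (c : ℕ → H) (hcn : ∀ t : ℕ, t < T → ‖c t‖ ≤ 1)
    (S : ℕ → H) (hS : ∀ t : ℕ, S t = ∑ s ∈ Finset.range t, c s)
    (y : ℕ → H)
    (hy : ∀ t : ℕ, y t = if S t = 0 then 0 else
      ((((F (t + 1) (‖S t‖ + 1) - F (t + 1) (‖S t‖ - 1)) /
            (F (t + 1) (‖S t‖ + 1) + F (t + 1) (‖S t‖ - 1))) * F t ‖S t‖) / ‖S t‖) • S t)
    (u : H) :
    ∑ t ∈ Finset.range T, (⟪u, c t⟫ - ⟪c t, y t⟫) ≤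
      sSup ((fun s : ℝ => ‖u‖ * s - F T s) '' Set.Icc (0 : ℝ) (T : ℝ)) + ε := by
  have hSn : ∀ t : ℕ, t ≤ T → ‖S t‖ ≤ (t : ℝ) := by
    intro t ht
    rw [hS]
    calc ‖∑ s ∈ Finset.range t, c s‖ ≤ ∑ s ∈ Finset.range t, (1 : ℝ) :=
          norm_sum_le_of_le _ (fun s hs => hcn s (lt_of_lt_of_le (Finset.mem_range.mp hs) ht))
      _ = t := by simp
  have step : ∀ t : ℕ, t < T → F (t + 1) ‖S (t + 1)‖ ≤ F t ‖S t‖ + ⟪c t, y t⟫ := by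
    intro t ht
    have hx := hSn t ht.le
    have hr := hcn t ht
    have hSs : S (t + 1) = S t + c t := by rw [hS, hS, Finset.sum_range_succ]
    have hx0 := norm_nonneg (S t)
    have hr0 := norm_nonneg (c t)
    have hxa : |‖S t‖| ≤ ((t + 1 : ℕ) : ℝ) - 1 := by
      rw [abs_of_nonneg hx0]; push_cast; linarith
    have h1 := hc (t + 1) (by omega) ‖S t‖ hxa ‖c t‖ (by rwa [abs_of_nonneg hr0])
    have h2 := hc (t + 1) (by omega) ‖S t‖ hxa (-‖c t‖) (by rwa [abs_neg, abs_of_nonneg hr0])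
    simp only [Nat.add_sub_cancel] at h1 h2
    by_cases h0 : S t = 0
    · rw [hy, if_pos h0, hSs, h0]
      simp only [h0, norm_zero, zero_add, zero_sub, heven, sub_self, zero_div, mul_zero,
        add_zero, one_mul] at h1
      simpa using h1
    have hxp : 0 < ‖S t‖ := norm_pos_iff.mpr h0
    have hyt : ⟪c t, y t⟫ = ((((F (t + 1) (‖S t‖ + 1) - F (t + 1) (‖S t‖ - 1)) /
            (F (t + 1) (‖S t‖ + 1) + F (t + 1) (‖S t‖ - 1))) * F t ‖S t‖) / ‖S t‖)
              * ⟪c t, S t⟫ := by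
      rw [hy, if_neg h0, real_inner_smul_right]
    obtain ⟨q, hq1, hq2, hq⟩ : ∃ q : ℝ, -1 ≤ q ∧ q ≤ 1 ∧ ⟪c t, S t⟫ = q * (‖c t‖ * ‖S t‖) := by
      have hab := abs_le.mp (abs_real_inner_le_norm (c t) (S t))
      rcases (mul_nonneg hr0 hx0).eq_or_lt with h | h
      · refine ⟨0, by norm_num, by norm_num, ?_⟩
        rw [← h] at hab
        rw [← h]
        linarith [hab.1, hab.2]
      · refine ⟨⟪c t, S t⟫ / (‖c t‖ * ‖S t‖), ?_, ?_, ?_⟩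
        · rw [le_div_iff₀ h]; linarith [hab.1]
        · rw [div_le_iff₀ h]; linarith [hab.2]
        · rw [div_mul_cancel₀ _ h.ne']
    rw [hyt, hq]
    generalize (F (t + 1) (‖S t‖ + 1) - F (t + 1) (‖S t‖ - 1)) /
            (F (t + 1) (‖S t‖ + 1) + F (t + 1) (‖S t‖ - 1)) = β at h1 h2 ⊢
    have hnsq : ‖S (t + 1)‖ ^ 2 = (1 + q) / 2 * (‖S t‖ + ‖c t‖) ^ 2
        + (1 - q) / 2 * (‖S t‖ + -‖c t‖) ^ 2 := by
      rw [hSs, norm_add_sq_real, real_inner_comm, hq]; ring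
    have m1 : (‖S t‖ + ‖c t‖) ^ 2 ∈ Set.Icc (0 : ℝ) (((t + 1 : ℕ) : ℝ) ^ 2) :=
      ⟨sq_nonneg _, by push_cast; apply pow_le_pow_left₀ <;> linarith⟩
    have m2 : (‖S t‖ + -‖c t‖) ^ 2 ∈ Set.Icc (0 : ℝ) (((t + 1 : ℕ) : ℝ) ^ 2) :=
      ⟨sq_nonneg _, by push_cast; apply sq_le_sq' <;> linarith⟩
    have hconv := (hd (t + 1) (by omega)).2 m1 m2
      (show 0 ≤ (1 + q) / 2 by linarith) (show 0 ≤ (1 - q) / 2 by linarith) (by ring)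
    simp only [smul_eq_mul] at hconv
    rw [← hnsq, Real.sqrt_sq (norm_nonneg _), Real.sqrt_sq (by linarith), Real.sqrt_sq_eq_abs]
      at hconv
    have habs : F (t + 1) |‖S t‖ + -‖c t‖| = F (t + 1) (‖S t‖ + -‖c t‖) := by
      rcases abs_choice (‖S t‖ + -‖c t‖) with h | h <;> rw [h]
      exact heven _ _
    rw [habs] at hconv
    have e1 := mul_le_mul_of_nonneg_left h1 (show 0 ≤ (1 + q) / 2 by linarith)
    have e2 := mul_le_mul_of_nonneg_left h2 (show 0 ≤ (1 - q) / 2 by linarith)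
    have e3 : β * F t ‖S t‖ / ‖S t‖ * (q * (‖c t‖ * ‖S t‖)) = β * F t ‖S t‖ * q * ‖c t‖ := by
      field_simp
    rw [e3]
    linarith
  have tele : ∀ t : ℕ, t ≤ T → F t ‖S t‖ ≤ ε + ∑ s ∈ Finset.range t, ⟪c s, y s⟫ := by
    intro t
    induction t with
    | zero => intro _; simp [hS, ha]
    | succ k ih =>
      intro hk
      rw [Finset.sum_range_succ]
      linarith [ih (by omega), step k (by omega)]
  have hfin := tele T le_rfl
  have hu : ∑ t ∈ Finset.range T, ⟪u, c t⟫ ≤ ‖u‖ * ‖S T‖ := by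
    rw [← inner_sum, ← hS]
    exact real_inner_le_norm _ _
  have hsup : ‖u‖ * ‖S T‖ - F T ‖S T‖ ≤
      sSup ((fun s : ℝ => ‖u‖ * s - F T s) '' Set.Icc (0 : ℝ) (T : ℝ)) := by
    apply le_csSup
    · refine ⟨‖u‖ * T, ?_⟩
      rintro _ ⟨s, ⟨hs0, hs1⟩, rfl⟩
      have := hpos T s (by rw [abs_of_nonneg hs0]; linarith)
      have := mul_le_mul_of_nonneg_left hs1 (norm_nonneg u)
      simp only
      linarith
    · exact ⟨‖S T‖, ⟨norm_nonneg _, hSn T le_rfl⟩, rfl⟩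
  rw [Finset.sum_sub_distrib]
  linarith
end

section
/- Let ε > 0 and let F : ℕ → ℝ → ℝ satisfy: (a) F_0(0) = ε; (b) for every t, F_t is even and F_t(x) > 0 for all |x| ≤ t + 1; (c) for every t ≥ 1, every real x with |x| ≤ t − 1, and every real c with |c| ≤ 1, (1 + c·β_t(x))·F_{t−1}(x) ≥ F_t(x + c), where β_t(x) = (F_t(x+1) − F_t(x−1))/(F_t(x+1) + F_t(x−1)). Let T ≥ 1 be an integer, let c_0,…,c_{T−1} ∈ [−1,1] be real numbers, and set S_t = Σ_{s=0}^{t−1} c_s and h_{t+1}(x) = β_{t+1}(x)·F_t(x). Then for every real θ ≥ 0, θ·S_T − Σ_{t=0}^{T−1} c_t·h_{t+1}(S_t) ≤ sup_{0 ≤ s ≤ T} (θ·s − F_T(s)) + ε. -/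
/-- One-dimensional coin-betting regret: for a coin-betting potential F with endowment ε,
scalar coins c_t ∈ [−1,1], wealth states S_t = Σ_{s<t} c_s, and bets h_{t+1}(x) =
β_{t+1}(x)·F_t(x), the linear regret θ·S_T − Σ_t c_t·h_{t+1}(S_t) is bounded by the
restricted terminal Fenchel conjugate of F_T at θ plus ε. -/
theorem one_dimensional_coin_betting_regret
    (ε : ℝ) (hε : 0 < ε) (F : ℕ → ℝ → ℝ)
    (ha : F 0 0 = ε)
    (heven : ∀ t : ℕ, ∀ x : ℝ, F t (-x) = F t x)
    (hpos : ∀ t : ℕ, ∀ x : ℝ, |x| ≤ (t : ℝ) + 1 → 0 < F t x)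
    (hc : ∀ t : ℕ, 1 ≤ t → ∀ x : ℝ, |x| ≤ (t : ℝ) - 1 → ∀ c : ℝ, |c| ≤ 1 →
      F t (x + c) ≤
        (1 + c * ((F t (x + 1) - F t (x - 1)) / (F t (x + 1) + F t (x - 1)))) * F (t - 1) x)
    (T : ℕ) (hT : 1 ≤ T)
    (c : ℕ → ℝ) (hcn : ∀ t : ℕ, t < T → c t ∈ Set.Icc (-1 : ℝ) 1)
    (S : ℕ → ℝ) (hS : ∀ t : ℕ, S t = ∑ s ∈ Finset.range t, c s)
    (θ : ℝ) (hθ : 0 ≤ θ) :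
    θ * S T - ∑ t ∈ Finset.range T,
        c t * (((F (t + 1) (S t + 1) - F (t + 1) (S t - 1)) /
            (F (t + 1) (S t + 1) + F (t + 1) (S t - 1))) * F t (S t)) ≤
      sSup ((fun s : ℝ => θ * s - F T s) '' Set.Icc (0 : ℝ) (T : ℝ)) + ε := by
  have key : ∀ n : ℕ, n ≤ T → |S n| ≤ (n : ℝ) ∧ F n (S n) ≤ ε + ∑ t ∈ Finset.range n,
        c t * (((F (t + 1) (S t + 1) - F (t + 1) (S t - 1)) /
            (F (t + 1) (S t + 1) + F (t + 1) (S t - 1))) * F t (S t)) := by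
    intro n
    induction n with
    | zero =>
      intro _
      have h0 : S 0 = 0 := by rw [hS]; simp
      simp [h0, ha]
    | succ k ih =>
      intro hk
      obtain ⟨h1, h2⟩ := ih (by omega)
      have hcc : |c k| ≤ 1 := abs_le.mpr (hcn k (by omega))
      have hstep : S (k + 1) = S k + c k := by
        rw [hS, hS, Finset.sum_range_succ]
      refine ⟨?_, ?_⟩
      · rw [hstep]
        push_cast
        exact (abs_add_le _ _).trans (add_le_add h1 hcc)
      · have h3 := hc (k + 1) (by omega) (S k) (by push_cast; linarith) (c k) hcc
        rw [Nat.add_sub_cancel] at h3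
        rw [hstep, Finset.sum_range_succ]
        linarith
  obtain ⟨h1, h2⟩ := key T le_rfl
  have habs : F T |S T| = F T (S T) := by
    rcases abs_choice (S T) with h | h <;> rw [h]
    exact heven _ _
  have hbdd : BddAbove ((fun s : ℝ => θ * s - F T s) '' Set.Icc (0 : ℝ) (T : ℝ)) := by
    refine ⟨θ * T, ?_⟩
    rintro _ ⟨s, ⟨hs0, hs1⟩, rfl⟩
    have hp := hpos T s (by rw [abs_of_nonneg hs0]; linarith)
    have hm := mul_le_mul_of_nonneg_left hs1 hθ
    simp only
    linarith
  have hle := le_csSup hbdd ⟨|S T|, ⟨abs_nonneg _, h1⟩, rfl⟩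
  simp only [habs] at hle
  have hm := mul_le_mul_of_nonneg_left (le_abs_self (S T)) hθ
  linarith
end

section
/- Let H be a real Hilbert space, N ≥ 1 an integer, and W an N×N real matrix that is symmetric, entrywise nonnegative, and doubly stochastic; let its Hilbert lift act on Z ∈ H^N by (WZ)_n = Σ_{j=1}^N W_{nj}·Z_j, and let L = I − W. Assume ‖WZ‖_{2,H} ≤ ‖Z‖_{2,H} for all Z ∈ H^N and ‖WZ‖_{2,H} ≤ ρ·‖Z‖_{2,H} whenever Σ_{n=1}^N Z_n = 0, for some ρ ∈ [0,1); set μ = 1 − ρ. Let 0 < γ ≤ 1, let Z, Ẑ, m ∈ H^N, and set e = Z − Ẑ, r = e − m, Ẑ′ = Ẑ + m, and Z′ = Z − γ·L·Ẑ′ (coordinatewise, Z′_n = Z_n + γ·Σ_j W_{nj}·(Ẑ′_j − Ẑ′_n)). Then ‖P⊥Z′‖_{2,H} ≤ (1 − γμ)·‖P⊥Z‖_{2,H} + 2γ·‖r‖_{2,H} and ‖Z′ − Ẑ′‖_{2,H} ≤ 2γ·‖P⊥Z‖_{2,H} + (1 + 2γ)·‖r‖_{2,H}. -/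
/-- Raw compressed-gossip recurrences: for a symmetric nonnegative doubly stochastic gossip
matrix W whose Hilbert lift is nonexpansive and contracts zero-mean vectors by ρ < 1, one
relaxed compressed gossip substep satisfies
‖P⊥Z′‖ ≤ (1 − γμ)‖P⊥Z‖ + 2γ‖r‖ and ‖Z′ − Ẑ′‖ ≤ 2γ‖P⊥Z‖ + (1 + 2γ)‖r‖, with μ = 1 − ρ. -/
theorem raw_compressed_gossip_recurrences
    {H : Type*} [NormedAddCommGroup H] [InnerProductSpace ℝ H]
    (N : ℕ) (hN : 1 ≤ N)
    (W : Matrix (Fin N) (Fin N) ℝ)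
    (hsymm : W.IsSymm)
    (hnonneg : ∀ i j, 0 ≤ W i j)
    (hrow : ∀ i, ∑ j, W i j = 1)
    (hcol : ∀ j, ∑ i, W i j = 1)
    (Wact : (Fin N → H) → (Fin N → H))
    (hWact : ∀ (Z : Fin N → H) (n : Fin N), Wact Z n = ∑ j, W n j • Z j)
    (netNorm : (Fin N → H) → ℝ)
    (hnetNorm : ∀ Z : Fin N → H, netNorm Z = Real.sqrt (∑ n, ‖Z n‖ ^ 2))
    (Pperp : (Fin N → H) → (Fin N → H))
    (hPperp : ∀ (Z : Fin N → H) (n : Fin N), Pperp Z n = Z n - (N : ℝ)⁻¹ • ∑ k, Z k)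
    (ρ : ℝ) (hρ0 : 0 ≤ ρ) (hρ1 : ρ < 1)
    (hnonexp : ∀ Z : Fin N → H, netNorm (Wact Z) ≤ netNorm Z)
    (hcontr : ∀ Z : Fin N → H, (∑ n, Z n) = 0 → netNorm (Wact Z) ≤ ρ * netNorm Z)
    (γ : ℝ) (hγ0 : 0 < γ) (hγ1 : γ ≤ 1)
    (Z Zhat m e r Zhat' Z' : Fin N → H)
    (he : e = Z - Zhat) (hr : r = e - m) (hZhat' : Zhat' = Zhat + m)
    (hZ' : ∀ n, Z' n = Z n + γ • (∑ j, W n j • (Zhat' j - Zhat' n))) :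
    netNorm (Pperp Z') ≤ (1 - γ * (1 - ρ)) * netNorm (Pperp Z) + 2 * γ * netNorm r ∧
    netNorm (Z' - Zhat') ≤ 2 * γ * netNorm (Pperp Z) + (1 + 2 * γ) * netNorm r := by
  have hnn : ∀ X : Fin N → H, netNorm X = ‖(WithLp.toLp 2 X : PiLp 2 (fun _ : Fin N => H))‖ := by
    intro X
    rw [hnetNorm, PiLp.norm_eq_of_L2]
  have hadd : ∀ X Y : Fin N → H, netNorm (X + Y) ≤ netNorm X + netNorm Y := by
    intro X Y
    rw [hnn, hnn, hnn, WithLp.toLp_add]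
    exact norm_add_le _ _
  have hsub : ∀ X Y : Fin N → H, netNorm (X - Y) ≤ netNorm X + netNorm Y := by
    intro X Y
    rw [hnn, hnn, hnn, WithLp.toLp_sub]
    exact norm_sub_le _ _
  have hsmul : ∀ (c : ℝ) (X : Fin N → H), 0 ≤ c → netNorm (c • X) = c * netNorm X := by
    intro c X hc
    rw [hnn, hnn, WithLp.toLp_smul, norm_smul, Real.norm_of_nonneg hc]
  have hN0 : (N : ℝ) ≠ 0 := by
    have : N ≠ 0 := by omega
    exact_mod_cast this
  have hPsum : ∑ n, Pperp Z n = 0 := by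
    simp only [hPperp, Finset.sum_sub_distrib, Finset.sum_const, Finset.card_univ,
      Fintype.card_fin]
    rw [← Nat.cast_smul_eq_nsmul ℝ, smul_smul, mul_inv_cancel₀ hN0, one_smul, sub_self]
  have hZr : ∀ n, Zhat' n = Z n - r n := by
    intro n
    rw [hZhat', hr, he]
    simp only [Pi.add_apply, Pi.sub_apply]
    abel
  have hWP : ∀ n, Wact (Pperp Z) n = (∑ j, W n j • Z j) - (N : ℝ)⁻¹ • ∑ k, Z k := by
    intro n
    rw [hWact]
    simp only [hPperp, smul_sub, Finset.sum_sub_distrib]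
    rw [← Finset.sum_smul, hrow, one_smul]
  have hZ2 : ∀ n, Z' n = Z n + γ • ((Wact (Pperp Z) n - Pperp Z n) + (r n - Wact r n)) := by
    intro n
    rw [hZ', hWP, hPperp, hWact]
    congr 2
    simp only [smul_sub, Finset.sum_sub_distrib, hZr]
    simp only [← Finset.sum_smul, hrow, one_smul]
    abel
  have hWsum : ∀ X : Fin N → H, ∑ n, Wact X n = ∑ n, X n := by
    intro X
    simp only [hWact]
    rw [Finset.sum_comm]
    simp only [← Finset.sum_smul, hcol, one_smul]
  have hZsum : ∑ n, Z' n = ∑ n, Z n := by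
    simp only [hZ2, Finset.sum_add_distrib, ← Finset.smul_sum, Finset.sum_sub_distrib, hWsum]
    simp
  have hP' : Pperp Z' = ((1 - γ) • Pperp Z + γ • Wact (Pperp Z)) + γ • (r - Wact r) := by
    funext n
    have h1 : Pperp Z' n = Pperp Z n + (Z' n - Z n) := by
      rw [hPperp Z', hPperp Z, hZsum]
      abel
    rw [h1, hZ2 n]
    simp only [Pi.add_apply, Pi.sub_apply, Pi.smul_apply]
    module
  have hD : Z' - Zhat' = (r + γ • (Wact (Pperp Z) - Pperp Z)) + γ • (r - Wact r) := by
    funext n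
    simp only [Pi.add_apply, Pi.sub_apply, Pi.smul_apply]
    rw [hZ2 n, hZr n]
    module
  have hrr : netNorm (γ • (r - Wact r)) ≤ γ * (2 * netNorm r) := by
    rw [hsmul _ _ hγ0.le]
    have := hsub r (Wact r)
    have := hnonexp r
    exact mul_le_mul_of_nonneg_left (by linarith) hγ0.le
  constructor
  · rw [hP']
    have h1 := hadd ((1 - γ) • Pperp Z + γ • Wact (Pperp Z)) (γ • (r - Wact r))
    have h2 := hadd ((1 - γ) • Pperp Z) (γ • Wact (Pperp Z))
    rw [hsmul _ _ (sub_nonneg.2 hγ1), hsmul _ _ hγ0.le] at h2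
    have h3 := mul_le_mul_of_nonneg_left (hcontr _ hPsum) hγ0.le
    linarith
  · rw [hD]
    have h1 := hadd (r + γ • (Wact (Pperp Z) - Pperp Z)) (γ • (r - Wact r))
    have h2 := hadd r (γ • (Wact (Pperp Z) - Pperp Z))
    rw [hsmul _ _ hγ0.le] at h2
    have h4 := hsub (Wact (Pperp Z)) (Pperp Z)
    have h5 := hnonexp (Pperp Z)
    have h3 : γ * netNorm (Wact (Pperp Z) - Pperp Z) ≤ γ * (2 * netNorm (Pperp Z)) :=
      mul_le_mul_of_nonneg_left (by linarith) hγ0.le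
    linarith
end

section
/- Let μ ∈ (0,1] and σ ∈ [0,1) be real numbers, and let γ be a real number with 0 < γ ≤ min{1, (1 − σ)/(2σ·(1 + 4/μ) + μ/2)}. Set χ = μ/4 and η̄ = 1 − γμ/2. Then 2γσ + χ·σ·(1 + 2γ) ≤ χ·η̄, and consequently for all real numbers D ≥ 0 and E ≥ 0, ((1 − γμ)·D + 2γσ·E) + χ·(2γ·D + σ·(1 + 2γ)·E) ≤ η̄·(D + χ·E). -/
/-- Scalar Lyapunov contraction algebra for the expected compressed-tracker contraction:
with χ = μ/4 and η̄ = 1 − γμ/2, the step-size condition implies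
2γσ + χσ(1 + 2γ) ≤ χη̄, and hence the Lyapunov contraction for all D, E ≥ 0. -/
theorem lyapunov_contraction_algebra (μ σ γ : ℝ)
    (hμ0 : 0 < μ) (hμ1 : μ ≤ 1) (hσ0 : 0 ≤ σ) (hσ1 : σ < 1)
    (hγ0 : 0 < γ) (hγ : γ ≤ min 1 ((1 - σ) / (2 * σ * (1 + 4 / μ) + μ / 2))) :
    2 * γ * σ + (μ / 4) * σ * (1 + 2 * γ) ≤ (μ / 4) * (1 - γ * μ / 2) ∧
    ∀ D E : ℝ, 0 ≤ D → 0 ≤ E →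
      ((1 - γ * μ) * D + 2 * γ * σ * E) + (μ / 4) * (2 * γ * D + σ * (1 + 2 * γ) * E) ≤
        (1 - γ * μ / 2) * (D + (μ / 4) * E) := by
  have hden : 0 < 2 * σ * (1 + 4 / μ) + μ / 2 := by positivity
  have h2 := (le_div_iff₀ hden).1 (hγ.trans (min_le_right _ _))
  have key : 2 * γ * σ + (μ / 4) * σ * (1 + 2 * γ) ≤ (μ / 4) * (1 - γ * μ / 2) := by
    have h3 := mul_le_mul_of_nonneg_left h2 (by positivity : 0 ≤ μ / 4)
    have h4 : μ / 4 * (γ * (2 * σ * (1 + 4 / μ) + μ / 2))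
        = 2 * γ * σ + μ / 4 * (2 * γ * σ) + μ / 4 * (γ * μ / 2) := by
      field_simp
      ring
    rw [h4] at h3
    linarith
  refine ⟨key, fun D E _ hE => ?_⟩
  have h5 := mul_le_mul_of_nonneg_right key hE
  linarith
end

section
/- Let H be a real Hilbert space, and let N ≥ 1 and T ≥ 1 be integers. For each n = 1,…,N and each t = 0,…,T−1, let ℓ_{n,t} : H → ℝ be convex and 1-Lipschitz, let x_{n,t} ∈ H, and let g_{n,t} ∈ H satisfy ‖g_{n,t}‖ ≤ 1 and ℓ_{n,t}(z) ≥ ℓ_{n,t}(x_{n,t}) + ⟨g_{n,t}, z − x_{n,t}⟩ for all z ∈ H. Define ℓ̄_t(x) = (1/N)·Σ_{n=1}^N ℓ_{n,t}(x) and ḡ_t = (1/N)·Σ_{n=1}^N g_{n,t}, and let y_t ∈ H for each t. Let u ∈ H, B ∈ ℝ, and C ≥ 0. If Σ_{t=0}^{T−1} ⟨ḡ_t, y_t − u⟩ ≤ B and Σ_{t=0}^{T−1} (1/N)·Σ_{n=1}^N ‖x_{n,t} − y_t‖ ≤ C·√T, then Σ_{t=0}^{T−1} (1/N)·Σ_{n=1}^N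 ℓ̄_t(x_{n,t}) − Σ_{t=0}^{T−1} ℓ̄_t(u) ≤ B + 3·C·√T. -/
open scoped RealInnerProductSpace

/-- General network-regret template: if the centralized coin-betting term is at most B and
the cumulative prediction disagreement is at most C·√T, then the network regret is at most
B + 3·C·√T. -/
theorem general_network_regret_template
    {H : Type*} [NormedAddCommGroup H] [InnerProductSpace ℝ H]
    (N T : ℕ) (hN : 1 ≤ N) (hT : 1 ≤ T)
    (ℓ : Fin N → ℕ → H → ℝ) (x g : Fin N → ℕ → H) (y : ℕ → H)
    (hconv : ∀ n, ∀ t < T, ConvexOn ℝ Set.univ (ℓ n t))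
    (hlip : ∀ n, ∀ t < T, LipschitzWith 1 (ℓ n t))
    (hgnorm : ∀ n, ∀ t < T, ‖g n t‖ ≤ 1)
    (hsub : ∀ n, ∀ t < T, ∀ z : H, ℓ n t (x n t) + ⟪g n t, z - x n t⟫ ≤ ℓ n t z)
    (u : H) (B C : ℝ) (hC : 0 ≤ C)
    (h1 : ∑ t ∈ Finset.range T, ⟪(1 / (N : ℝ)) • ∑ n, g n t, y t - u⟫ ≤ B)
    (h2 : ∑ t ∈ Finset.range T, (1 / (N : ℝ)) * ∑ n, ‖x n t - y t‖ ≤ C * Real.sqrt T) :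
    ∑ t ∈ Finset.range T, (1 / (N : ℝ)) * ∑ n, ((1 / (N : ℝ)) * ∑ m, ℓ m t (x n t)) -
        ∑ t ∈ Finset.range T, (1 / (N : ℝ)) * ∑ m, ℓ m t u ≤
      B + 3 * C * Real.sqrt T := by
  have hN0 : (N : ℝ) ≠ 0 := by
    have : N ≠ 0 := by omega
    exact_mod_cast this
  have hNp : (0 : ℝ) ≤ 1 / (N : ℝ) := by positivity
  have key : ∀ t ∈ Finset.range T,
      (1 / (N : ℝ)) * ∑ n, ((1 / (N : ℝ)) * ∑ m, ℓ m t (x n t)) ≤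
        (1 / (N : ℝ)) * ∑ m, ℓ m t u + ⟪(1 / (N : ℝ)) • ∑ n, g n t, y t - u⟫ +
          3 * ((1 / (N : ℝ)) * ∑ n, ‖x n t - y t‖) := by
    intro t ht
    have ht := Finset.mem_range.mp ht
    have pt : ∀ n m, ℓ m t (x n t) ≤
        ℓ m t u + ⟪g m t, y t - u⟫ + ‖x n t - y t‖ + 2 * ‖x m t - y t‖ := by
      intro n m
      have a1 := (hlip m t ht).dist_le_mul (x n t) (x m t)
      rw [Real.dist_eq, dist_eq_norm] at a1
      have a2 := le_abs_self (ℓ m t (x n t) - ℓ m t (x m t))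
      have a3 := norm_sub_le (x n t - y t) (x m t - y t)
      rw [sub_sub_sub_cancel_right] at a3
      have a4 := hsub m t ht u
      have a5 : ⟪g m t, u - x m t⟫ = -⟪g m t, y t - u⟫ - ⟪g m t, x m t - y t⟫ := by
        simp only [inner_sub_right]; ring
      have a6 := real_inner_le_norm (g m t) (x m t - y t)
      have a7 := mul_le_mul_of_nonneg_right (hgnorm m t ht) (norm_nonneg (x m t - y t))
      simp only [NNReal.coe_one, one_mul] at a1 a7
      linarith
    calc _ ≤ (1 / (N : ℝ)) * ∑ n, ((1 / (N : ℝ)) * ∑ m,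
            (ℓ m t u + ⟪g m t, y t - u⟫ + ‖x n t - y t‖ + 2 * ‖x m t - y t‖)) := by
          refine mul_le_mul_of_nonneg_left (Finset.sum_le_sum fun n _ => ?_) hNp
          exact mul_le_mul_of_nonneg_left (Finset.sum_le_sum fun m _ => pt n m) hNp
      _ = _ := by
          rw [real_inner_smul_left, sum_inner]
          simp only [Finset.sum_add_distrib, ← Finset.mul_sum, Finset.sum_const,
            Finset.card_univ, Fintype.card_fin, nsmul_eq_mul]
          field_simp
          ring
  have := Finset.sum_le_sum key
  rw [Finset.sum_add_distrib, Finset.sum_add_distrib, ← Finset.mul_sum _ _ (3 : ℝ)] at this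
  linarith
end

section
/- Let H be a real Hilbert space, let t ≥ 0 be an integer, and let F_t, F_{t+1} : ℝ → ℝ be even functions with F_{t+1}(x) > 0 for all |x| ≤ t + 2. Assume: (i) for every real x with |x| ≤ t and every real c with |c| ≤ 1, (1 + c·β_{t+1}(x))·F_t(x) ≥ F_{t+1}(x + c), where β_{t+1}(x) = (F_{t+1}(x+1) − F_{t+1}(x−1))/(F_{t+1}(x+1) + F_{t+1}(x−1)); and (ii) the map z ↦ F_{t+1}(√z) is convex on [0, (t+1)²]. Let S, c ∈ H with ‖S‖ ≤ t and ‖c‖ ≤ 1, and define Bet_{t+1}(S) = (h_{t+1}(‖S‖)/‖S‖)·S for S ≠ 0 with h_{t+1}(x) = β_{t+1}(x)·F_t(x), and Bet_{t+1}(0) = 0. Then ⟨c, Bet_{t+1}(S)⟩ ≥ F_{t+1}(‖S + c‖) − F_t(‖S‖). -/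
open scoped RealInnerProductSpace
open Classical

/-- One-step reward inequality for the radial betting map: under the scalar coin-betting
inequality (i) and square-root-lift convexity (ii), for ‖S‖ ≤ t and ‖c‖ ≤ 1,
⟨c, Bet_{t+1}(S)⟩ ≥ F_{t+1}(‖S + c‖) − F_t(‖S‖). -/
theorem one_step_reward_inequality
    {H : Type*} [NormedAddCommGroup H] [InnerProductSpace ℝ H]
    (t : ℕ) (Ft Ft1 : ℝ → ℝ)
    (hevenFt : ∀ x : ℝ, Ft (-x) = Ft x)
    (hevenFt1 : ∀ x : ℝ, Ft1 (-x) = Ft1 x)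
    (hpos : ∀ x : ℝ, |x| ≤ (t : ℝ) + 2 → 0 < Ft1 x)
    (hi : ∀ x : ℝ, |x| ≤ (t : ℝ) → ∀ c : ℝ, |c| ≤ 1 →
      Ft1 (x + c) ≤
        (1 + c * ((Ft1 (x + 1) - Ft1 (x - 1)) / (Ft1 (x + 1) + Ft1 (x - 1)))) * Ft x)
    (hii : ConvexOn ℝ (Set.Icc (0 : ℝ) (((t : ℝ) + 1) ^ 2)) (fun z => Ft1 (Real.sqrt z)))
    (S c : H) (hS : ‖S‖ ≤ (t : ℝ)) (hc : ‖c‖ ≤ 1) :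
    Ft1 ‖S + c‖ - Ft ‖S‖ ≤
      ⟪c, (if S = 0 then 0 else
        ((((Ft1 (‖S‖ + 1) - Ft1 (‖S‖ - 1)) / (Ft1 (‖S‖ + 1) + Ft1 (‖S‖ - 1))) * Ft ‖S‖) /
          ‖S‖) • S : H)⟫ := by
  have hr0 := norm_nonneg S
  have hρ0 := norm_nonneg c
  by_cases hS0 : S = 0
  · subst hS0
    have h := hi 0 (by simp) ‖c‖ (by rwa [abs_of_nonneg hρ0])
    have e : Ft1 (0 - 1) = Ft1 (0 + 1) := by
      rw [← hevenFt1 (0 - 1)]; norm_num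
    rw [e] at h
    simp at h
    simpa using h
  · rw [if_neg hS0, inner_smul_right]
    have hrpos : 0 < ‖S‖ := norm_pos_iff.mpr hS0
    have hsq : ‖S + c‖ ^ 2 = ‖S‖ ^ 2 + 2 * ⟪c, S⟫ + ‖c‖ ^ 2 := by
      rw [norm_add_sq_real, real_inner_comm]
    have hcs : |⟪c, S⟫| ≤ ‖c‖ * ‖S‖ := abs_real_inner_le_norm c S
    have hiS := hi ‖S‖ (by rwa [abs_of_nonneg hr0])
    generalize (Ft1 (‖S‖ + 1) - Ft1 (‖S‖ - 1)) / (Ft1 (‖S‖ + 1) + Ft1 (‖S‖ - 1)) = β at *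
    have hn := norm_nonneg (S + c)
    obtain ⟨s, hs⟩ : ∃ s, s * ‖S‖ = ⟪c, S⟫ := ⟨⟪c, S⟫ / ‖S‖, by field_simp⟩
    rw [← hs] at hsq hcs ⊢
    have hsρ : |s| ≤ ‖c‖ := by
      rw [abs_mul, abs_of_pos hrpos] at hcs
      exact le_of_mul_le_mul_right hcs hrpos
    obtain ⟨hs1, hs2⟩ := abs_le.mp hsρ
    have e : β * Ft ‖S‖ / ‖S‖ * (s * ‖S‖) = s * β * Ft ‖S‖ := by field_simp
    rw [e]
    generalize ‖S‖ = r at *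
    generalize ‖c‖ = ρ at *
    generalize ‖S + c‖ = n at *
    obtain ⟨a, b, ha, hb, hab, habs⟩ : ∃ a b : ℝ, 0 ≤ a ∧ 0 ≤ b ∧ a + b = 1 ∧ (a - b) * ρ = s := by
      rcases hρ0.eq_or_lt with h | h
      · refine ⟨1, 0, by norm_num, by norm_num, by norm_num, ?_⟩
        linarith
      · refine ⟨(ρ + s) / (2 * ρ), (ρ - s) / (2 * ρ), div_nonneg (by linarith) (by linarith),
          div_nonneg (by linarith) (by linarith), ?_, ?_⟩ <;> field_simp <;> ring
    have hconv := hii.2 (x := (r + ρ) ^ 2) ⟨by positivity, by gcongr⟩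
      (y := (r - ρ) ^ 2) ⟨by positivity, by nlinarith [mul_nonneg hr0 hρ0]⟩ ha hb hab
    have hz : a • (r + ρ) ^ 2 + b • (r - ρ) ^ 2 = n ^ 2 := by
      rw [hsq, ← habs]
      simp only [smul_eq_mul]
      linear_combination (r ^ 2 + ρ ^ 2) * hab
    have habsF : Ft1 |r - ρ| = Ft1 (r + -ρ) := by
      rcases abs_choice (r - ρ) with h | h <;> rw [h]
      · rfl
      · rw [hevenFt1]; rfl
    rw [hz] at hconv
    simp only [smul_eq_mul, Real.sqrt_sq_eq_abs] at hconv
    rw [abs_of_nonneg hn, abs_of_nonneg (add_nonneg hr0 hρ0), habsF] at hconv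
    have h1 := mul_le_mul_of_nonneg_left (hiS ρ (by rwa [abs_of_nonneg hρ0])) ha
    have h2 := mul_le_mul_of_nonneg_left (hiS (-ρ) (by rwa [abs_neg, abs_of_nonneg hρ0])) hb
    have e2 : a * ((1 + ρ * β) * Ft r) + b * ((1 + -ρ * β) * Ft r) = Ft r + s * β * Ft r := by
      rw [← habs]
      linear_combination (Ft r) * hab
    linarith
end
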